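/- arXiv:math/0409348 — 2 statements merged into one kernel-verified Lean document; each statement's English description precedes it below -/
import Mathlib

section
/- Let α_ℝ be the unique real number satisfying 7α_ℝ³ + 7α_ℝ + 1 = 0, and let S_{α_ℝ} := P − U_{a₁,…,a₅} with a₁ := −(12/7)α_ℝ² − (384/49)α_ℝ − 8/7, a₂ := −(32/7)α_ℝ² + (24/49)α_ℝ − 4, a₃ := −4α_ℝ² + (24/49)α_ℝ − 4, a₄ := −(8/7)α_ℝ² + (8/49)α_ℝ − 8/7, a₅ := 49α_ℝ² − 7α_ℝ + 50. Then every singular point of the surface {S_{α_ℝ} = 0} in ℙ³(ℂ) is real, i.e., can be represented by a nonzero vector with real coordinates. -/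
open MvPolynomial

noncomputable def Psept : MvPolynomial (Fin 4) ℂ :=
  X 0 * ((X 0) ^ 6 - 21 * (X 0) ^ 4 * (X 1) ^ 2 + 35 * (X 0) ^ 2 * (X 1) ^ 4
      - 7 * (X 1) ^ 6)
    + 7 * X 2 * (((X 0) ^ 2 + (X 1) ^ 2) ^ 3
        - 8 * (X 2) ^ 2 * ((X 0) ^ 2 + (X 1) ^ 2) ^ 2
        + 16 * (X 2) ^ 4 * ((X 0) ^ 2 + (X 1) ^ 2))
    - 64 * (X 2) ^ 7

noncomputable def Usept (a₁ a₂ a₃ a₄ a₅ : ℂ) : MvPolynomial (Fin 4) ℂ :=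
  (X 2 + C a₅ * X 3) *
    (C a₁ * (X 2) ^ 3 + C a₂ * (X 2) ^ 2 * X 3 + C a₃ * X 2 * (X 3) ^ 2
        + C a₄ * (X 3) ^ 3 + (X 2 + X 3) * ((X 0) ^ 2 + (X 1) ^ 2)) ^ 2

/-- All partial derivatives of `F` vanish at `v`. -/
def VanishingJacobianAt (F : MvPolynomial (Fin 4) ℂ) (v : Fin 4 → ℂ) : Prop :=
  ∀ i, eval v (pderiv i F) = 0

/-- A point of ℙ³(ℂ) is a singular point of `{F = 0}` if it is represented by a
nonzero vector at which all four partial derivatives of `F` vanish. -/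
def IsSingularPoint (F : MvPolynomial (Fin 4) ℂ)
    (p : Projectivization ℂ (Fin 4 → ℂ)) : Prop :=
  ∃ v : Fin 4 → ℂ, ∃ hv : v ≠ 0, Projectivization.mk ℂ v hv = p ∧
    VanishingJacobianAt F v

theorem aux_n1 (b z x : ℂ) (hb : b^3 + 49*b + 49 = 0)
    (e1 : x^2*((7350 - 147*b + 147*b^2) + (2548 - 49*b + 49*b^2)*z) = (20384 - 400*b + 408*b^2) + (51156 - 1004*b + 1024*b^2)*z + (31360 - 612*b + 628*b^2)*z^2 + (588
      - 8*b + 12*b^2)*z^3)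
    (e3 : 49*(x^2 + 2*x*z - 4*z^2)^2 = 16*(z+1)^2*(x-z)*(z + (b^2 - b + 50))) :
      x*(((7350 - 147*b + 147*b^2) + (2548 - 49*b + 49*b^2)*z)*((- 7794 + 153*b - 156*b^2) + (- 13340
      + 262*b - 267*b^2)*z + (- 753 + 15*b - 15*b^2)*z^2 + (- 2462 + 52*b - 49*b^2)*z^3 + (- 2453 +
      48*b - 47*b^2)*z^4)) = (- 26968816 + 529396*b - 539788*b^2) + (- 194874911 + 3825381*b -
      3900473*b^2)*z + (- 375289285 + 7366905*b - 7511515*b^2)*z^2 + (- 250790575 + 4923030*b -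
      5019640*b^2)*z^3 + (- 88517471 + 1737687*b - 1771704*b^2)*z^4 + (- 27610226 + 542675*b -
      552597*b^2)*z^5 + (- 6500536 + 127694*b - 129903*b^2)*z^6 := by
  linear_combination (-49*(x^2*((7350 - 147*b + 147*b^2) + (2548 - 49*b + 49*b^2)*z) + ((20384 - 400*b + 408*b^2) +
      (51156 - 1004*b + 1024*b^2)*z + (31360 - 612*b + 628*b^2)*z^2 + (588 - 8*b + 12*b^2)*z^3) +
      (-4*z^2 + 4*x*z)*((7350 - 147*b + 147*b^2) + (2548 - 49*b + 49*b^2)*z))/784)*e1 + (((7350 - 147*b + 147*b^2) + (2548 - 49*b + 49*b^2)*z)^2/784)*e3 + ((20400 - 10404*b) + (191927 - 98088*b + 1323*b^2 - 441*b^3)*z^1 + (402216 - 205903*b + 3528*b^2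
      - 1176*b^3)*z^2 + (297661 - 153026*b + 3234*b^2 - 1078*b^3)*z^3 + (107069 - 54997*b + 1176*b^2 -
      392*b^3)*z^4 + (25556 - 12898*b + 147*b^2 - 49*b^3)*z^5 + (4667 - 2312*b)*z^6 + (- 44100 +
      22932*b - 1323*b^2 + 441*b^3)*x^1 + (- 118188 + 61446*b - 3528*b^2 + 1176*b^3)*x^1*z^1 + (-
      109172 + 56742*b - 3234*b^2 + 1078*b^3)*x^1*z^2 + (- 40180 + 20874*b - 1176*b^2 +
      392*b^3)*x^1*z^3 + (- 5096 + 2646*b - 147*b^2 + 49*b^3)*x^1*z^4)*hb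

theorem aux_n2 (b z x : ℂ) (hb : b^3 + 49*b + 49 = 0)
    (e1 : x^2*((7350 - 147*b + 147*b^2) + (2548 - 49*b + 49*b^2)*z) = (20384 - 400*b + 408*b^2) + (51156 - 1004*b + 1024*b^2)*z + (31360 - 612*b + 628*b^2)*z^2 + (588
      - 8*b + 12*b^2)*z^3)
    (e2 : 49*(x^2 + 2*x*z - 4*z^2)*((z+1)*((20384 - 400*b + 408*b^2) + (51156 - 1004*b + 1024*b^2)*z +
      (31360 - 612*b + 628*b^2)*z^2 + (588 - 8*b + 12*b^2)*z^3) + ((- 392 + 8*b - 8*b^2) + (- 1372 +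
      24*b - 28*b^2)*z + (- 1372 + 24*b - 32*b^2)*z^2 + (- 392 - 384*b - 12*b^2)*z^3)*((7350 - 147*b +
      147*b^2) + (2548 - 49*b + 49*b^2)*z)/343) = 28*(z+1)*((7350 - 147*b + 147*b^2) + (2548 - 49*b + 49*b^2)*z)*(x-z)*(x^3 + 4*x^2*z - 4*x*z^2 -
      8*z^3)) :
      x*(((7350 - 147*b + 147*b^2) + (2548 - 49*b + 49*b^2)*z)*((- 5096 + 100*b - 102*b^2)*z + (-
      20384 + 400*b - 408*b^2)*z^2 + (- 18326 + 355*b - 367*b^2)*z^3 + (4116 - 90*b + 82*b^2)*z^4 +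
      (2352 - 145*b + 45*b^2)*z^5)) = 98*((269894 - 5298*b + 5402*b^2)*z + (- 365871 + 7182*b -
      7323*b^2)*z^2 + (- 4969158 + 97544*b - 99459*b^2)*z^3 + (- 7892096 + 154919*b - 157962*b^2)*z^4
      + (- 3066684 + 60183*b - 61380*b^2)*z^5 + (135399 - 2705*b + 2717*b^2)*z^6 + (123580 - 2637*b +
      2473*b^2)*z^7) := by
  linear_combination (-1/16*(7*((z+1)*((20384 - 400*b + 408*b^2) + (51156 - 1004*b + 1024*b^2)*z + (31360 - 612*b +
      628*b^2)*z^2 + (588 - 8*b + 12*b^2)*z^3) + ((- 392 + 8*b - 8*b^2) + (- 1372 + 24*b - 28*b^2)*z +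
      (- 1372 + 24*b - 32*b^2)*z^2 + (- 392 - 384*b - 12*b^2)*z^3)*((7350 - 147*b + 147*b^2) + (2548 -
      49*b + 49*b^2)*z)/343) - 4*(z+1)*(x^2*((7350 - 147*b + 147*b^2) + (2548 - 49*b + 49*b^2)*z) +
      ((20384 - 400*b + 408*b^2) + (51156 - 1004*b + 1024*b^2)*z + (31360 - 612*b + 628*b^2)*z^2 +
      (588 - 8*b + 12*b^2)*z^3) - 8*z^2*((7350 - 147*b + 147*b^2) + (2548 - 49*b + 49*b^2)*z) +
      3*x*z*((7350 - 147*b + 147*b^2) + (2548 - 49*b + 49*b^2)*z))))*e1 + (1/112*((7350 - 147*b + 147*b^2) + (2548 - 49*b + 49*b^2)*z))*e2 + ((- 61152 + 31776*b - 1824*b^2 + 612*b^3) + (- 392592 + 211454*b - 11264*b^2 + 3882*b^3)*z^1 + (-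
      807691 + 457656*b - 25647*b^2 + 9110*b^3)*z^2 + (1028009 + 279786*b + 3735*b^2 + 9624*b^3)*z^3 +
      (4546238 - 180560*b + 75082*b^2 + 3910*b^3)*z^4 + (1722290 - 167950*b + 29590*b^2 - 488*b^3)*z^5
      + (- 600127 - 22708*b - 10479*b^2 - 752*b^3)*z^6 + (- 240839 + 1290*b - 4137*b^2 - 138*b^3)*z^7
      + (- 44100 + 22932*b - 1323*b^2 + 441*b^3)*x^1*z^1 + (- 173313 + 191247/2*b - 5292*b^2 +
      3675/2*b^3)*x^1*z^2 + (- 256907 + 148323*b - 7938*b^2 + 2842*b^3)*x^1*z^3 + (903805 + 83839*b +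
      16121*b^2 + 2009*b^3)*x^1*z^4 + (679385 + 19355*b + 12691*b^2 + 637*b^3)*x^1*z^5 + (118482 +
      3087/2*b + 2205*b^2 + 147/2*b^3)*x^1*z^6)*hb

theorem aux_C (b z x : ℂ) (hb : b^3 + 49*b + 49 = 0)
    (n1 : x*(((7350 - 147*b + 147*b^2) + (2548 - 49*b + 49*b^2)*z)*((- 7794 + 153*b - 156*b^2) + (- 13340
      + 262*b - 267*b^2)*z + (- 753 + 15*b - 15*b^2)*z^2 + (- 2462 + 52*b - 49*b^2)*z^3 + (- 2453 +
      48*b - 47*b^2)*z^4)) = (- 26968816 + 529396*b - 539788*b^2) + (- 194874911 + 3825381*b - 3900473*b^2)*z + (- 375289285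
      + 7366905*b - 7511515*b^2)*z^2 + (- 250790575 + 4923030*b - 5019640*b^2)*z^3 + (- 88517471 +
      1737687*b - 1771704*b^2)*z^4 + (- 27610226 + 542675*b - 552597*b^2)*z^5 + (- 6500536 + 127694*b
      - 129903*b^2)*z^6)
    (n2 : x*(((7350 - 147*b + 147*b^2) + (2548 - 49*b + 49*b^2)*z)*((- 5096 + 100*b - 102*b^2)*z + (-
      20384 + 400*b - 408*b^2)*z^2 + (- 18326 + 355*b - 367*b^2)*z^3 + (4116 - 90*b + 82*b^2)*z^4 +
      (2352 - 145*b + 45*b^2)*z^5)) = 98*((269894 - 5298*b + 5402*b^2)*z + (- 365871 + 7182*b - 7323*b^2)*z^2 + (- 4969158 + 97544*b -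
      99459*b^2)*z^3 + (- 7892096 + 154919*b - 157962*b^2)*z^4 + (- 3066684 + 60183*b - 61380*b^2)*z^5
      + (135399 - 2705*b + 2717*b^2)*z^6 + (123580 - 2637*b + 2473*b^2)*z^7)) :
      ((28128048815 - 552188405*b + 562987570*b^2) + (74432905843 - 1460963101*b + 1489685678*b^2)*z +
      (- 10606096623 + 207190731*b - 212790873*b^2)*z^2 + (- 117511527682 + 2317480309*b -
      2359133732*b^2)*z^3 + (- 35741868132 + 685501566*b - 729691791*b^2)*z^4 +
      (4631683083)*z^5)*((1154599564 - 22664708*b + 23109616*b^2)*z + (2375884268 - 46638400*b +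
      47553956*b^2)*z^2 + (1289253508 - 25307996*b + 25804804*b^2)*z^3 + (1975343521 - 38775722*b +
      39537205*b^2)*z^4 + (1677017554 - 32924492*b + 33567598*b^2)*z^5 + (293454601 - 5783364*b +
      5874113*b^2)*z^6) = 0 := by
  linear_combination ((-4631683083/49)*((- 5096 + 100*b - 102*b^2)*z + (- 20384 + 400*b - 408*b^2)*z^2 + (- 18326 +
      355*b - 367*b^2)*z^3 + (4116 - 90*b + 82*b^2)*z^4 + (2352 - 145*b + 45*b^2)*z^5))*n1 + ((4631683083/49)*((- 7794 + 153*b - 156*b^2) + (- 13340 + 262*b - 267*b^2)*z + (- 753 + 15*b -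
      15*b^2)*z^2 + (- 2462 + 52*b - 49*b^2)*z^3 + (- 2453 + 48*b - 47*b^2)*z^4))*n2 + ((- 101453709127828/49 - 13189074097736/49*b)*z^1 + (- 360282294697804/49 -
      186601690638182/49*b)*z^2 + (- 14535413064398768/49 - 1644119947260400/49*b)*z^3 + (-
      85226197571047429/49 - 15650808275402039/49*b)*z^4 + (- 76445743124729603/7 -
      8956182194568409/7*b)*z^5 + (- 288163524415132318/7 - 38396218856116504/7*b)*z^6 + (-
      451525518169328241/7 - 72976289479799695/7*b)*z^7 + (- 1913775831885022813/49 -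
      404065083272039453/49*b)*z^8 + (- 379676659809578659/49 - 288723000801760939/49*b)*z^9 +
      (51140530556495664/49 - 158482016913071538/49*b)*z^10 + (- 3719940899794533/49 -
      25682696590284249/49*b)*z^11)*hb

theorem aux_K (b z x : ℂ) (hb : b^3 + 49*b + 49 = 0)
    (e1 : x^2*((7350 - 147*b + 147*b^2) + (2548 - 49*b + 49*b^2)*z) = (20384 - 400*b + 408*b^2) + (51156 - 1004*b + 1024*b^2)*z + (31360 - 612*b + 628*b^2)*z^2 + (588
      - 8*b + 12*b^2)*z^3)
    (n1 : x*(((7350 - 147*b + 147*b^2) + (2548 - 49*b + 49*b^2)*z)*((- 7794 + 153*b - 156*b^2) + (- 13340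
      + 262*b - 267*b^2)*z + (- 753 + 15*b - 15*b^2)*z^2 + (- 2462 + 52*b - 49*b^2)*z^3 + (- 2453 +
      48*b - 47*b^2)*z^4)) = (- 26968816 + 529396*b - 539788*b^2) + (- 194874911 + 3825381*b - 3900473*b^2)*z + (- 375289285
      + 7366905*b - 7511515*b^2)*z^2 + (- 250790575 + 4923030*b - 5019640*b^2)*z^3 + (- 88517471 +
      1737687*b - 1771704*b^2)*z^4 + (- 27610226 + 542675*b - 552597*b^2)*z^5 + (- 6500536 + 127694*b
      - 129903*b^2)*z^6) :
      ((28128048815 - 552188405*b + 562987570*b^2) + (74432905843 - 1460963101*b + 1489685678*b^2)*z +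
      (- 10606096623 + 207190731*b - 212790873*b^2)*z^2 + (- 117511527682 + 2317480309*b -
      2359133732*b^2)*z^3 + (- 35741868132 + 685501566*b - 729691791*b^2)*z^4 + (4631683083)*z^5)*((-
      30551773535640 + 599729200760*b - 611501843480*b^2) + (- 91011694394348 + 1786553264328*b -
      1821623181244*b^2)*z + (- 80068638870157 + 1571741842356*b - 1602595024976*b^2)*z^2 + (-
      29545311850677 + 579972428924*b - 591357245492*b^2)*z^3 + (- 12591095378526 + 247162338780*b -
      252014107227*b^2)*z^4 + (- 4825325730533 + 94720742165*b - 96580152297*b^2)*z^5 + (1186827314645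
      - 23297740676*b + 23754670113*b^2)*z^6 + (691171274388 - 13567812905*b + 13833933083*b^2)*z^7) =
      0 := by
  linear_combination ((-4631683083/49)*(x*(((7350 - 147*b + 147*b^2) + (2548 - 49*b + 49*b^2)*z)*((- 7794 + 153*b -
      156*b^2) + (- 13340 + 262*b - 267*b^2)*z + (- 753 + 15*b - 15*b^2)*z^2 + (- 2462 + 52*b -
      49*b^2)*z^3 + (- 2453 + 48*b - 47*b^2)*z^4)) + (- 26968816 + 529396*b - 539788*b^2) + (-
      194874911 + 3825381*b - 3900473*b^2)*z + (- 375289285 + 7366905*b - 7511515*b^2)*z^2 + (-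
      250790575 + 4923030*b - 5019640*b^2)*z^3 + (- 88517471 + 1737687*b - 1771704*b^2)*z^4 + (-
      27610226 + 542675*b - 552597*b^2)*z^5 + (- 6500536 + 127694*b - 129903*b^2)*z^6))*n1 + ((4631683083/49)*((7350 - 147*b + 147*b^2) + (2548 - 49*b + 49*b^2)*z)*((- 7794 + 153*b -
      156*b^2) + (- 13340 + 262*b - 267*b^2)*z + (- 753 + 15*b - 15*b^2)*z^2 + (- 2462 + 52*b -
      49*b^2)*z^3 + (- 2453 + 48*b - 47*b^2)*z^4)^2)*e1 + ((- 1384282521196790259048 + 36405889733546847437800/49*b - 62169739909565405256*b^2 +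
      21620628490122482904*b^3 - 543849115114828224*b^4 + 137965166757654912*b^5) + (-
      8684045032224929375260 + 228363565057599961715176/49*b - 389864536662496711284*b^2 +
      135571425827665086936*b^3 - 3408139662939974736*b^4 + 864519284004038208*b^5)*z^1 + (-
      21137183913074309941690 + 555863248426265502821237/49*b - 948477956298915002652*b^2 +
      329822544199345554132*b^3 - 8283142658685680136*b^4 + 2101177222079916312*b^5)*z^2 + (-
      25765970685171843119584 + 677255550683497989325702/49*b - 1154832525189658580100*b^2 +
      401411941918550837712*b^3 - 10070639421870406428*b^4 + 2553428393979032664*b^5)*z^3 + (-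
      19218781468505333463583 + 503848212473228152776571/49*b - 859084774136507678568*b^2 +
      297724945159257194004*b^3 - 7476537662050488948*b^4 + 1889041671936024300*b^5)*z^4 + (-
      14164885143640328966568 + 369718254040986729754780/49*b - 626757120856702139772*b^2 +
      215858925010577745864*b^3 - 5440309846354385352*b^4 + 1364421026193735240*b^5)*z^5 + (-
      11508140336589436411753 + 42820825070712136469635/7*b - 498338669443257563676*b^2 +
      171327659568970325820*b^3 - 4309614034659330024*b^4 + 1078676119172083752*b^5)*z^6 + (-
      6262057505089246888003 + 162805152749368024442465/49*b - 265865676560576743692*b^2 +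
      91398886408463699736*b^3 - 2288908637853536976*b^4 + 572938567458200712*b^5)*z^7 + (-
      2446680804643110945763 + 63292400199855014362408/49*b - 103935197095030638540*b^2 +
      35542351287043030260*b^3 - 892792559681256768*b^4 + 222084090451726368*b^5)*z^8 + (-
      1225331026705338110744 + 31536034494834681720768/49*b - 52309914303700861296*b^2 +
      17808937357372468992*b^3 - 447866598371960568*b^4 + 110840289110767704*b^5)*z^9 + (-
      490745565590920237839 + 12623651568985435022918/49*b - 20911984683769949304*b^2 +
      7141482393315365232*b^3 - 177609706098679104*b^4 + 44130157666318704*b^5)*z^10 + (-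
      71854253657353060161 + 1860974167951063012893/49*b - 3342678789056672496*b^2 +
      1149322625435112792*b^3 - 28136974507452036*b^4 + 7049643973113984*b^5)*z^11 +
      (1206728205787587756 - 26377097345879341395/49*b - 54130795145470644*b^2 + 19828050010999680*b^3
      - 455405607452892*b^4 + 122776655164164*b^5)*z^12)*hb

theorem aux_G (b z : ℂ) (hb : b^3 + 49*b + 49 = 0)
    (h1 : ((28128048815 - 552188405*b + 562987570*b^2) + (74432905843 - 1460963101*b + 1489685678*b^2)*z +
      (- 10606096623 + 207190731*b - 212790873*b^2)*z^2 + (- 117511527682 + 2317480309*b -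
      2359133732*b^2)*z^3 + (- 35741868132 + 685501566*b - 729691791*b^2)*z^4 +
      (4631683083)*z^5)*((1154599564 - 22664708*b + 23109616*b^2)*z + (2375884268 - 46638400*b +
      47553956*b^2)*z^2 + (1289253508 - 25307996*b + 25804804*b^2)*z^3 + (1975343521 - 38775722*b +
      39537205*b^2)*z^4 + (1677017554 - 32924492*b + 33567598*b^2)*z^5 + (293454601 - 5783364*b +
      5874113*b^2)*z^6) = 0)
    (h2 : ((28128048815 - 552188405*b + 562987570*b^2) + (74432905843 - 1460963101*b + 1489685678*b^2)*z +
      (- 10606096623 + 207190731*b - 212790873*b^2)*z^2 + (- 117511527682 + 2317480309*b -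
      2359133732*b^2)*z^3 + (- 35741868132 + 685501566*b - 729691791*b^2)*z^4 + (4631683083)*z^5)*((-
      30551773535640 + 599729200760*b - 611501843480*b^2) + (- 91011694394348 + 1786553264328*b -
      1821623181244*b^2)*z + (- 80068638870157 + 1571741842356*b - 1602595024976*b^2)*z^2 + (-
      29545311850677 + 579972428924*b - 591357245492*b^2)*z^3 + (- 12591095378526 + 247162338780*b -
      252014107227*b^2)*z^4 + (- 4825325730533 + 94720742165*b - 96580152297*b^2)*z^5 + (1186827314645
      - 23297740676*b + 23754670113*b^2)*z^6 + (691171274388 - 13567812905*b + 13833933083*b^2)*z^7) = 0) :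
      3738102377598607620000*((28128048815 - 552188405*b + 562987570*b^2) + (74432905843 -
      1460963101*b + 1489685678*b^2)*z + (- 10606096623 + 207190731*b - 212790873*b^2)*z^2 + (-
      117511527682 + 2317480309*b - 2359133732*b^2)*z^3 + (- 35741868132 + 685501566*b -
      729691791*b^2)*z^4 + (4631683083)*z^5) = 0 := by
  linear_combination ((- 3875736531894175974060 - 2455681673643967740580*b + 1525507278343479796980*b^2) + (-
      177651288811821201856577 - 179395458365083846750648*b + 1777333991513423969987*b^2)*z + (-
      621835295978685211593737 - 740095836115262489065980*b - 108135786692683058774717*b^2)*z^2 + (-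
      2922545087737498744244122 - 3465568783440351144128453*b - 495187698337322740490318*b^2)*z^3 + (-
      3022262261673817148360794 - 7340979149505413281275623*b - 4343001621169168879168925*b^2)*z^4 +
      (64380506131188718089082569 + 57881271129331746263584207*b - 7915407426264301402154147*b^2)*z^5
      + (68549691957294511170425085 + 73562159333341302986778101*b +
      3738821513738846398998052*b^2)*z^6)*h1 + ((18117173073599866000 + 16106939416821218000*b - 2412314424590087500*b^2) +
      (7496673305021517735916 + 7529481970547257615676*b - 116595205332756333932*b^2)*z +
      (20395117897902814036992 + 30870645870474726577868*b + 10272948172564478752068*b^2)*z^2 +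
      (72582735041065588201261 + 108882475512901841789037*b + 35559539189799883325775*b^2)*z^3 +
      (384703993504532047366594 + 728095114604376921220934*b + 342431912673553225558662*b^2)*z^4 + (-
      3487022729585554268133437 - 3054773070753401994974463*b + 510528373716850283541047*b^2)*z^5)*h2 + ((317738899061476012717852129205853209100000 - 47730269119165931616191313043625669200000*b +
      7174149138221814282728586341145832300000*b^2 - 830482510135060824008082698109065000000*b^3) +
      (133266520040342303053049978536468214415794800 - 4856056735635138070045849630824393974675200*b +
      2711321505187050231142900857370965970055600*b^2 -
      44831277328980440343080639684111718112800*b^3)*z^1 +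
      (1100612611470962171929985450381516973361986420 +
      143385988320506174169181601628493976953971940*b +
      18789462514420748329295645738257508990421080*b^2 +
      3302335193905449817079502393136908698394080*b^3)*z^2 +
      (4618230827514087188802393352805326633058182552 +
      1494573734485504661757809524296165567886926636*b +
      61310948582045168828249814742764921776545732*b^2 +
      31728144732284235981222879689493945957273800*b^3)*z^3 +
      (17872543619071689814802655132942852166530732452 +
      10764951232425250103137085223496093845221612476*b +
      139451774364048492680740270718410282692521092*b^2 +
      222477289821046276240631736989319975945186240*b^3)*z^4 + (-
      10915086503361224445990947743218571120518202214 +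
      48809894861076518627638670588470407684094442161*b -
      1172707927763585501552755493591848232829316545*b^2 +
      972553262040354818522186360660032470274470598*b^3)*z^5 + (-
      278393692518891829234750588142123077145304038984 +
      114072431239079982109230349700164394069378928196*b -
      7705486355328396635536629558136567754376729840*b^2 +
      2173170925829506983040130026870889142245430280*b^3)*z^6 + (-
      622688929137410219028846863019161678067609841732 +
      106932096677921283576849804103311877053894721524*b -
      14325542099500019607500042364660728587546880476*b^2 +
      1891623873615631944198329557080213644370088765*b^3)*z^7 + (-
      258882320406472158861145019403367607413101899581 -
      50713391280297691059086888407941769072844691863*b -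
      4079926112340295836940642670456415609113094947*b^2 -
      1132483445166935453041966934899367490260935089*b^3)*z^8 +
      (615325347244165575645554591484251941248051412221 -
      200291184290922918949578457026160508096362601719*b +
      16060951449593737987139070054196111940546186677*b^2 -
      3819641923097782354764089566459249018657212737*b^3)*z^9 +
      (788388881140657700639618588137159073646379684733 -
      176818073928679963288544488723306795430006030783*b +
      19268453331725906794513080451930373328251960302*b^2 -
      3349299694865011723460912776373939131382671104*b^3)*z^10 +
      (387802221689033968596215940622317164449628221014 -
      83129364790124746786783333684748103100733516966*b +
      9989737800559748335151066869354665077091329987*b^2 -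
      1659216489346317637830880299315774529559133343*b^3)*z^11 +
      (158750816334208976226756185357303322220766324531 -
      33635605539062097864192755639472232661075694165*b +
      4396593290624271825644034970979553261469180250*b^2 -
      703752525883996167814926139789706611694841614*b^3)*z^12 +
      (66595507549747494519130903127877240312493029212 -
      10568778365205061906446799234037784627867722287*b +
      1745281595120514696745315437198343527997997496*b^2 -
      220818897447017086108040813529996689283815233*b^3)*z^13 + (-
      667660734180469849802834523907071604248924625 + 1294355269043800216819457033103746069925610891*b
      + 58592286616597538367159935565908870005565614*b^2 +
      11690853295979933410581383037844234212985656*b^3)*z^14 + (-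
      10120141364703574964257250103569935212491566002 +
      1792541420128316237578280766145170685208298342*b -
      198778023483122027008913556193007629286549799*b^2 +
      29077086845874920876886139548776517878653686*b^3)*z^15 + (-
      1389936125347813968759390412278524478296356050 + 208174439060267539883219266284579828520114092*b
      - 40447782783490310143682862635141353763692671*b^2 +
      5169558131308703073115117419087185259656607*b^3)*z^16 +
      (225914002473500299290999987654546409283870757 -
      32813518308262854877611472898623766029510491*b)*z^17)*hb

theorem aux_ne (b z : ℂ) (hb : b^3 + 49*b + 49 = 0)
    (h1 : ((7350 - 147*b + 147*b^2) + (2548 - 49*b + 49*b^2)*z)*((- 7794 + 153*b - 156*b^2) + (- 13340 +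
      262*b - 267*b^2)*z + (- 753 + 15*b - 15*b^2)*z^2 + (- 2462 + 52*b - 49*b^2)*z^3 + (- 2453 + 48*b
      - 47*b^2)*z^4) = 0)
    (h2 : (- 26968816 + 529396*b - 539788*b^2) + (- 194874911 + 3825381*b - 3900473*b^2)*z + (- 375289285
      + 7366905*b - 7511515*b^2)*z^2 + (- 250790575 + 4923030*b - 5019640*b^2)*z^3 + (- 88517471 +
      1737687*b - 1771704*b^2)*z^4 + (- 27610226 + 542675*b - 552597*b^2)*z^5 + (- 6500536 + 127694*b
      - 129903*b^2)*z^6 = 0) :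
      False := by
  have key : (19377802081400 : ℂ) = 0 := by
    linear_combination ((10316213006876 + 6445672028880*b - 4152836521404*b^2) + (- 465793597005037 - 501717845141044*b
      - 27305544164380*b^2)*z + (308366485488012 - 684877685368632*b - 1018912777785712*b^2)*z^2 +
      (4196428610140942 + 2024936313048852*b - 2298110903312929*b^2)*z^3 + (36348703632985359 +
      14405844804053171*b - 23101124479609994*b^2)*z^4 + (389878680770533878 + 386234355419965815*b -
      11519388294448437*b^2)*z^5)*h1 + ((443316874923741 + 461782770006012*b + 9954910556080*b^2) + (- 101858168107556 +
      783065037573889*b + 904332775179372*b^2)*z + (- 5041091327487614 - 3247436084285505*b +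
      1929763320746261*b^2)*z^2 + (- 38799042117299660 - 17337375619718301*b +
      22659530558697998*b^2)*z^3 + (- 391245055285032879 - 387798818323847973*b +
      11344759791760815*b^2)*z^4)*h2 + ((256055199909832346744 + 370717048409493268*b + 336446444278010052*b^2 - 95232847108836528*b^3)
      + (1187291880239431760983 + 496266040848896749760*b - 9577021869561001212*b^2 -
      820909701775759932*b^3)*z^1 + (- 536282405138224617971 + 3422671470244612202463*b +
      9810700505843732544*b^2 - 24709635267421443276*b^3)*z^2 + (- 34637589715159422251449 +
      21432674297760832046528*b + 206644904121050502919*b^2 - 100930568498969427036*b^3)*z^3 + (-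
      355313666247907769560039 + 79777570846336010414060*b + 1705171941848114321386*b^2 -
      653352854019848646741*b^3)*z^4 + (- 1332338914960783736284579 + 144867105549480080394516*b +
      12309821470691239824413*b^2 - 1390929070309233217546*b^3)*z^5 + (- 2234929750858512892990659 +
      136742141708718413625667*b + 20168241016972631367190*b^2 - 921140033315741720775*b^3)*z^6 + (-
      1743949012605209742360161 + 72208307068917095310458*b + 6810924428578657346953*b^2 -
      383227103001755700954*b^3)*z^7 + (- 551495421007853431550791 + 12969410257853218501682*b +
      3840304390241155425176*b^2 - 311804922596830412533*b^3)*z^8 + (- 27597468348034208496110 -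
      3253475893943084753426*b + 3954431954197398449951*b^2 - 160447394697856764652*b^3)*z^9 + (-
      2172769009967382517488 - 917588961259001953992*b + 943120473042838746180*b^2 -
      26529151242114750411*b^3)*z^10)*hb
  norm_num at key

/-- A real polynomial of degree at most `n` whose values alternate in sign at `n + 1` points has
only real complex roots. -/
theorem real_of_signs (n : ℕ) (p : Polynomial ℝ) (hn : p.natDegree ≤ n) (hp : p ≠ 0)
    (t : Fin (n + 1) → ℝ) (ht : StrictMono t)
    (h : ∀ i : Fin n, p.eval (t i.castSucc) * p.eval (t i.succ) < 0)
    (z : ℂ) (hz : Polynomial.aeval z p = 0) : ∃ r : ℝ, z = r := by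
  have hroot : ∀ i : Fin n, ∃ r, t i.castSucc < r ∧ r < t i.succ ∧ p.eval r = 0 := by
    intro i
    have hlt : t i.castSucc < t i.succ := ht Fin.castSucc_lt_succ
    have hc : ContinuousOn (fun r => p.eval r) (Set.Icc (t i.castSucc) (t i.succ)) :=
      p.continuous.continuousOn
    rcases mul_neg_iff.1 (h i) with ⟨h1, h2⟩ | ⟨h1, h2⟩
    · obtain ⟨r, hr, hr0⟩ := intermediate_value_Ioo' hlt.le hc (Set.mem_Ioo.2 ⟨h2, h1⟩)
      exact ⟨r, hr.1, hr.2, hr0⟩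
    · obtain ⟨r, hr, hr0⟩ := intermediate_value_Ioo hlt.le hc (Set.mem_Ioo.2 ⟨h1, h2⟩)
      exact ⟨r, hr.1, hr.2, hr0⟩
  choose r hr1 hr2 hr0 using hroot
  have hmono : StrictMono r := by
    intro i j hij
    have h1 : t i.succ ≤ t j.castSucc := ht.monotone (by
      rw [Fin.le_def]; simpa using hij)
    linarith [hr2 i, hr1 j]
  have hsub : Finset.univ.image r ⊆ p.roots.toFinset := by
    intro s hs
    obtain ⟨i, -, rfl⟩ := Finset.mem_image.1 hs
    simp [hp, hr0 i]
  have hcard : n ≤ p.roots.card := by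
    calc n = (Finset.univ.image r).card := by
          rw [Finset.card_image_of_injective _ hmono.injective]; simp
      _ ≤ p.roots.toFinset.card := Finset.card_le_card hsub
      _ ≤ p.roots.card := Multiset.toFinset_card_le _
  have hspl : p.Splits := Polynomial.splits_iff_card_roots.2
    (le_antisymm (Polynomial.card_roots' p) (hn.trans hcard))
  have hmem : z ∈ (p.map (algebraMap ℝ ℂ)).roots := by
    rw [Polynomial.mem_roots_map hp, ← Polynomial.aeval_def]; exact hz
  rw [hspl.roots_map (algebraMap ℝ ℂ)] at hmem
  obtain ⟨s, -, hs⟩ := Multiset.mem_map.1 hmem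
  exact ⟨s, hs.symm⟩

theorem real_cubic (c0 c1 c2 c3 t0 t1 t2 t3 : ℝ) (h01 : t0 < t1) (h12 : t1 < t2) (h23 : t2 < t3)
    (s0 : (c0 + c1*t0 + c2*t0^2 + c3*t0^3) * (c0 + c1*t1 + c2*t1^2 + c3*t1^3) < 0)
    (s1 : (c0 + c1*t1 + c2*t1^2 + c3*t1^3) * (c0 + c1*t2 + c2*t2^2 + c3*t2^3) < 0)
    (s2 : (c0 + c1*t2 + c2*t2^2 + c3*t2^3) * (c0 + c1*t3 + c2*t3^2 + c3*t3^3) < 0)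
    (z : ℂ) (hz : (c0 : ℂ) + c1*z + c2*z^2 + c3*z^3 = 0) : ∃ r : ℝ, z = r := by
  set p : Polynomial ℝ := Polynomial.C c0 + Polynomial.C c1 * Polynomial.X
    + Polynomial.C c2 * Polynomial.X^2 + Polynomial.C c3 * Polynomial.X^3 with hp
  have hev : ∀ t, p.eval t = c0 + c1*t + c2*t^2 + c3*t^3 := by intro t; simp [hp]
  refine real_of_signs 3 p (by rw [hp]; compute_degree) ?_ ![t0, t1, t2, t3] ?_ ?_ z ?_
  · intro h0
    have := hev t0
    rw [h0] at this
    simp only [Polynomial.eval_zero] at this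
    rw [← this] at s0
    simp at s0
  · rw [Fin.strictMono_iff_lt_succ]
    intro i
    fin_cases i <;> simpa
  · intro i
    rw [hev, hev]
    fin_cases i
    · exact s0
    · exact s1
    · exact s2
  · simpa [hp] using hz

theorem real_quintic (c0 c1 c2 c3 c4 c5 t0 t1 t2 t3 t4 t5 : ℝ) (f : ℝ → ℝ)
    (hf : ∀ t, f t = c0 + c1*t + c2*t^2 + c3*t^3 + c4*t^4 + c5*t^5)
    (h01 : t0 < t1) (h12 : t1 < t2) (h23 : t2 < t3) (h34 : t3 < t4) (h45 : t4 < t5)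
    (s0 : f t0 * f t1 < 0) (s1 : f t1 * f t2 < 0) (s2 : f t2 * f t3 < 0)
    (s3 : f t3 * f t4 < 0) (s4 : f t4 * f t5 < 0)
    (z : ℂ) (hz : (c0 : ℂ) + c1*z + c2*z^2 + c3*z^3 + c4*z^4 + c5*z^5 = 0) :
    ∃ r : ℝ, z = r := by
  set p : Polynomial ℝ := Polynomial.C c0 + Polynomial.C c1 * Polynomial.X
    + Polynomial.C c2 * Polynomial.X^2 + Polynomial.C c3 * Polynomial.X^3
    + Polynomial.C c4 * Polynomial.X^4 + Polynomial.C c5 * Polynomial.X^5 with hp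
  have hev : ∀ t, p.eval t = f t := by intro t; rw [hf]; simp [hp]
  refine real_of_signs 5 p (by rw [hp]; compute_degree) ?_ ![t0, t1, t2, t3, t4, t5] ?_ ?_ z ?_
  · intro h0
    have := hev t0
    rw [h0] at this
    simp only [Polynomial.eval_zero] at this
    rw [← this] at s0
    simp at s0
  · rw [Fin.strictMono_iff_lt_succ]
    intro i
    fin_cases i <;> simpa
  · intro i
    rw [hev, hev]
    fin_cases i
    · exact s0
    · exact s1
    · exact s2
    · exact s3
    · exact s4
  · simpa [hp] using hz

theorem b_bounds (b : ℝ) (hb : b^3 + 49*b + 49 = 0) :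
    -0.980749 < b ∧ b < -0.980747 ∧ 0.961864 < b^2 ∧ b^2 < 0.961869 := by
  have h1 : -0.980749 < b := by
    by_contra h
    push Not at h
    nlinarith [sq_nonneg b, sq_nonneg (b + 0.980749), sq_nonneg (b - 0.980749)]
  have h2 : b < -0.980747 := by
    by_contra h
    push Not at h
    nlinarith [sq_nonneg b, sq_nonneg (b + 0.980747), sq_nonneg (b - 0.980747)]
  refine ⟨h1, h2, ?_, ?_⟩ <;> nlinarith

/-- The point with coordinates `(x : z : w)` has a real representative. -/
def RealPt (x z w : ℂ) : Prop :=
  ∃ l : ℂ, l ≠ 0 ∧ ∃ r s t : ℝ, l * x = r ∧ l * z = s ∧ l * w = t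

theorem planar_struct (a₁ a₂ a₃ a₄ a₅ x z w : ℂ) (h5 : a₅ ≠ 0) (R M Q B : ℂ)
    (hR : R = x^3 + 4*x^2*z - 4*x*z^2 - 8*z^3) (hM : M = x^2 + 2*x*z - 4*z^2)
    (hQ : Q = a₁*z^3 + a₂*z^2*w + a₃*z*w^2 + a₄*w^3 + (z + w)*x^2) (hB : B = z + a₅*w)
    (hx : x*(7*R*M - 4*(z + w)*B*Q) = 0)
    (hz : 7*x^6 - 168*z^2*x^4 + 560*z^4*x^2 - 448*z^6 - Q^2
      - 2*B*Q*(3*a₁*z^2 + 2*a₂*z*w + a₃*w^2 + x^2) = 0)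
    (hw : Q*(a₅*Q + 2*B*(a₂*z^2 + 2*a₃*z*w + 3*a₄*w^2 + x^2)) = 0) :
    (R = 0 ∧ Q = 0) ∨
    (Q ≠ 0 ∧ a₅*Q + 2*B*(a₂*z^2 + 2*a₃*z*w + 3*a₄*w^2 + x^2) = 0 ∧
      (x = 0 ∨ (7*M*Q = 4*(z + w)*(x - z)*R ∧ 49*M^2 = 16*(z + w)^2*(x - z)*B))) := by
  have hf : (x - z)*R^2 = B*Q^2 := by
    have : 7*((x - z)*R^2 - B*Q^2) = 0 := by
      have hx' : x*(x*(7*R*M - 4*(z + w)*B*Q)) = 0 := by rw [hx, mul_zero]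
      have e : 7*((x - z)*R^2 - B*Q^2) = x*(x*(7*R*M - 4*(z + w)*B*Q))
          + z*(7*x^6 - 168*z^2*x^4 + 560*z^4*x^2 - 448*z^6 - Q^2
          - 2*B*Q*(3*a₁*z^2 + 2*a₂*z*w + a₃*w^2 + x^2))
          - w*(Q*(a₅*Q + 2*B*(a₂*z^2 + 2*a₃*z*w + 3*a₄*w^2 + x^2))) := by
        have e1 : 7*((x - z)*R^2) = x^2*(7*R*M)
            + z*(7*x^6 - 168*z^2*x^4 + 560*z^4*x^2 - 448*z^6) := by
          rw [hR, hM]; ring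
        have e2 : 7*(B*Q^2) = Q^2*B + 2*B*Q*(3*Q) := by ring
        have e3 : Q*3 = z*(3*a₁*z^2 + 2*a₂*z*w + a₃*w^2 + x^2)
            + w*(a₂*z^2 + 2*a₃*z*w + 3*a₄*w^2 + x^2) + 2*x^2*(z + w) := by rw [hQ]; ring
        linear_combination e1 - e2 - 2*B*Q*e3 - Q^2*hB
      rw [e, hx', hz, hw]; ring
    have h7 : (7 : ℂ) ≠ 0 := by norm_num
    exact sub_eq_zero.1 ((mul_eq_zero.1 this).resolve_left h7)
  by_cases hR0 : R = 0
  · left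
    refine ⟨hR0, ?_⟩
    by_contra hQ0
    have hB0 : B = 0 := by
      rw [hR0] at hf
      have : B*Q^2 = 0 := by rw [← hf]; ring
      exact (mul_eq_zero.1 this).resolve_right (pow_ne_zero 2 hQ0)
    have := (mul_eq_zero.1 hw).resolve_left hQ0
    rw [hB0] at this
    simp [h5, hQ0] at this
  · right
    have hQ0 : Q ≠ 0 := by
      intro hQ0
      rw [hQ0] at hf hz
      have hA : x - z = 0 := by
        have : (x - z)*R^2 = 0 := by rw [hf]; ring
        exact (mul_eq_zero.1 this).resolve_right (pow_ne_zero 2 hR0)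
      have hxz : x = z := sub_eq_zero.1 hA
      have hRz : R^2 = 0 := by
        rw [hR]
        rw [hxz] at hz ⊢
        linear_combination -hz
      exact hR0 (pow_eq_zero_iff (two_ne_zero) |>.1 hRz)
    refine ⟨hQ0, (mul_eq_zero.1 hw).resolve_left hQ0, ?_⟩
    rcases mul_eq_zero.1 hx with h | h
    · left; exact h
    · right
      constructor
      · apply mul_left_cancel₀ hR0
        linear_combination Q*h - 4*(z + w)*hf
      · apply mul_left_cancel₀ (pow_ne_zero 2 hR0)
        linear_combination (7*R*M + 4*(z + w)*B*Q)*h - 16*(z + w)^2*B*hf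

theorem caseA (b : ℝ) (hb : b^3 + 49*b + 49 = 0) (x z w a₁ a₂ a₃ a₄ : ℂ)
    (ha₁ : a₁ = -(12/343)*(b : ℂ)^2 - (384/343)*(b : ℂ) - 8/7)
    (ha₂ : a₂ = -(32/343)*(b : ℂ)^2 + (24/343)*(b : ℂ) - 4)
    (ha₃ : a₃ = -(4/49)*(b : ℂ)^2 + (24/343)*(b : ℂ) - 4)
    (ha₄ : a₄ = -(8/343)*(b : ℂ)^2 + (8/343)*(b : ℂ) - 8/7)
    (h0 : ¬ (x = 0 ∧ z = 0 ∧ w = 0))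
    (hR : x^3 + 4*x^2*z - 4*x*z^2 - 8*z^3 = 0)
    (hQ : a₁*z^3 + a₂*z^2*w + a₃*z*w^2 + a₄*w^3 + (z + w)*x^2 = 0) : RealPt x z w := by
  obtain ⟨hb1, hb2, hb3, hb4⟩ := b_bounds b hb
  have ha4 : a₄ ≠ 0 := by
    intro h
    rw [ha₄] at h
    have : (-(8/343)*b^2 + (8/343)*b - 8/7 : ℝ) = 0 := by
      apply Complex.ofReal_injective
      push_cast
      exact h
    linarith
  by_cases hz : z = 0
  · exfalso
    subst hz
    have hx : x = 0 := by
      have : x^3 = 0 := by linear_combination hR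
      exact pow_eq_zero_iff (three_ne_zero) |>.1 this
    subst hx
    have hw : w = 0 := by
      have : a₄*w^3 = 0 := by linear_combination hQ
      exact pow_eq_zero_iff (three_ne_zero) |>.1 ((mul_eq_zero.1 this).resolve_left ha4)
    exact h0 ⟨rfl, rfl, hw⟩
  · obtain ⟨c, rfl⟩ : ∃ c, x = c*z := ⟨x/z, by field_simp⟩
    obtain ⟨t, rfl⟩ : ∃ t, w = t*z := ⟨w/z, by field_simp⟩
    have hz3 : z^3 ≠ 0 := pow_ne_zero 3 hz
    have hc : ((-8 : ℝ) : ℂ) + ((-4 : ℝ) : ℂ)*c + ((4 : ℝ) : ℂ)*c^2 + ((1 : ℝ) : ℂ)*c^3 = 0 := by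
      push_cast
      apply mul_left_cancel₀ hz3
      linear_combination hR
    obtain ⟨cr, rfl⟩ := real_cubic _ _ _ _ (-5) (-4) 0 2 (by norm_num) (by norm_num) (by norm_num)
      (by norm_num) (by norm_num) (by norm_num) c hc
    have hcr : cr^3 + 4*cr^2 - 4*cr - 8 = 0 := by
      have : ((-8 : ℝ)) + (-4 : ℝ)*cr + (4 : ℝ)*cr^2 + (1 : ℝ)*cr^3 = 0 := by exact_mod_cast hc
      linarith
    obtain ⟨s, hs⟩ : ∃ s, s = cr^2 := ⟨_, rfl⟩
    have hs0 : 0 ≤ s := by rw [hs]; positivity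
    have hs3 : s^3 - 24*s^2 + 80*s - 64 = 0 := by
      rw [hs]
      linear_combination (cr^3 - 4*cr^2 - 4*cr + 8)*hcr
    have hs1 : 1.2 < s := by
      by_contra h
      push Not at h
      nlinarith [mul_nonneg hs0 (sub_nonneg.2 h), mul_nonneg hs0 (mul_nonneg hs0 (sub_nonneg.2 h))]
    have hs2 : s < 25 := by
      by_contra h
      push Not at h
      nlinarith [mul_nonneg hs0 (sub_nonneg.2 h), mul_nonneg hs0 (mul_nonneg hs0 (sub_nonneg.2 h))]
    have hs4 : s < 3.5 ∨ 19 < s := by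
      by_contra h
      push Not at h
      nlinarith [mul_nonneg hs0 (mul_nonneg (sub_nonneg.2 h.1) (sub_nonneg.2 h.2)),
        mul_nonneg (sub_nonneg.2 h.1) (sub_nonneg.2 h.2)]
    have ht : ((-(12/343)*b^2 - (384/343)*b - 8/7 + s : ℝ) : ℂ)
        + ((-(32/343)*b^2 + (24/343)*b - 4 + s : ℝ) : ℂ)*t
        + ((-(4/49)*b^2 + (24/343)*b - 4 : ℝ) : ℂ)*t^2
        + ((-(8/343)*b^2 + (8/343)*b - 8/7 : ℝ) : ℂ)*t^3 = 0 := by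
      rw [hs]
      push_cast
      apply mul_left_cancel₀ hz3
      rw [ha₁, ha₂, ha₃, ha₄] at hQ
      linear_combination hQ
    have : ∃ r : ℝ, t = r := by
      rcases hs4 with hs4 | hs4
      · refine real_cubic _ _ _ _ (-3) (-2) 0 1 (by norm_num) (by norm_num) (by norm_num)
          ?_ ?_ ?_ t ht
        · apply mul_neg_of_pos_of_neg <;> linarith
        · apply mul_neg_of_neg_of_pos <;> linarith
        · apply mul_neg_of_pos_of_neg <;> linarith
      · refine real_cubic _ _ _ _ (-6) (-2) 0 4 (by norm_num) (by norm_num) (by norm_num)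
          ?_ ?_ ?_ t ht
        · apply mul_neg_of_pos_of_neg <;> linarith
        · apply mul_neg_of_neg_of_pos <;> linarith
        · apply mul_neg_of_pos_of_neg <;> linarith
    obtain ⟨r, rfl⟩ := this
    refine ⟨z⁻¹, inv_ne_zero hz, cr, 1, r, ?_, ?_, ?_⟩
    · field_simp
    · simp [hz]
    · field_simp

theorem caseB_affine (b : ℝ) (hb' : b^3 + 49*b + 49 = 0) (x z a₁ a₂ a₃ a₄ a₅ : ℂ)
    (ha₁ : a₁ = -(12/343)*(b : ℂ)^2 - (384/343)*(b : ℂ) - 8/7)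
    (ha₂ : a₂ = -(32/343)*(b : ℂ)^2 + (24/343)*(b : ℂ) - 4)
    (ha₃ : a₃ = -(4/49)*(b : ℂ)^2 + (24/343)*(b : ℂ) - 4)
    (ha₄ : a₄ = -(8/343)*(b : ℂ)^2 + (8/343)*(b : ℂ) - 8/7)
    (ha₅ : a₅ = (b : ℂ)^2 - b + 50)
    (e1 : x^2*((7350 - 147*b + 147*b^2) + (2548 - 49*b + 49*b^2)*z) = (20384 - 400*b + 408*b^2) + (51156 -
      1004*b + 1024*b^2)*z + (31360 - 612*b + 628*b^2)*z^2 + (588 - 8*b + 12*b^2)*z^3)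
    (h : x = 0 ∨ (7*(x^2 + 2*x*z - 4*z^2)*(a₁*z^3 + a₂*z^2 + a₃*z + a₄ + (z + 1)*x^2)
        = 4*(z + 1)*(x - z)*(x^3 + 4*x^2*z - 4*x*z^2 - 8*z^3) ∧
      49*(x^2 + 2*x*z - 4*z^2)^2 = 16*(z + 1)^2*(x - z)*(z + a₅))) :
    ∃ r s : ℝ, x = r ∧ z = s := by
  obtain ⟨hb1, hb2, hb3, hb4⟩ := b_bounds b hb'
  have hb : (b : ℂ)^3 + 49*b + 49 = 0 := by exact_mod_cast congrArg Complex.ofReal hb'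
  rcases h with rfl | ⟨E2, E3⟩
  · have hz : ((20384 - 400*b + 408*b^2 : ℝ) : ℂ) + ((51156 - 1004*b + 1024*b^2 : ℝ) : ℂ)*z + ((31360 - 612*b
      + 628*b^2 : ℝ) : ℂ)*z^2 + ((588 - 8*b + 12*b^2 : ℝ) : ℂ)*z^3 = 0 := by
      push_cast
      linear_combination -e1
    obtain ⟨s, hs⟩ : ∃ s : ℝ, z = s := by
      refine real_cubic _ _ _ _ (-100) (-10) (-0.8) 0 (by norm_num) (by norm_num) (by norm_num)
          ?_ ?_ ?_ z hz
      · apply mul_neg_of_neg_of_pos <;> linarith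
      · apply mul_neg_of_pos_of_neg <;> linarith
      · apply mul_neg_of_neg_of_pos <;> linarith
    exact ⟨0, s, by simp, hs⟩
  · have e3 : 49*(x^2 + 2*x*z - 4*z^2)^2 = 16*(z+1)^2*(x-z)*(z + ((b : ℂ)^2 - b + 50)) := by
      rw [← ha₅]; exact E3
    have n1 := aux_n1 b z x hb e1 e3
    have n2 := aux_n2 b z x hb e1 (by
      rw [ha₁, ha₂, ha₃, ha₄] at E2
      linear_combination 7*((7350 - 147*b + 147*b^2) + (2548 - 49*b + 49*b^2)*z)*E2 - 49*(x^2 + 2*x*z - 4*z^2)*(z + 1)*e1)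
    have hC := aux_C b z x hb n1 n2
    have hK := aux_K b z x hb e1 n1
    have hG := aux_G b z hb hC hK
    have hG' := (mul_eq_zero.1 hG).resolve_left (by norm_num)
    have hz : ((28128048815 - 552188405*b + 562987570*b^2 : ℝ) : ℂ) + ((74432905843 - 1460963101*b +
      1489685678*b^2 : ℝ) : ℂ)*z + ((- 10606096623 + 207190731*b - 212790873*b^2 : ℝ) : ℂ)*z^2 + ((-
      117511527682 + 2317480309*b - 2359133732*b^2 : ℝ) : ℂ)*z^3 + ((- 35741868132 + 685501566*b -
      729691791*b^2 : ℝ) : ℂ)*z^4 + ((4631683083 : ℝ) : ℂ)*z^5 = 0 := by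
      push_cast
      linear_combination hG'
    obtain ⟨s, hs⟩ : ∃ s : ℝ, z = s := by
      refine real_quintic _ _ _ _ _ _ (-3) (-1) (-0.57) 0 5 20 _ (fun t => rfl)
        (by norm_num) (by norm_num) (by norm_num) (by norm_num) (by norm_num)
        ?_ ?_ ?_ ?_ ?_ z hz
      · apply mul_neg_of_neg_of_pos <;> linarith
      · apply mul_neg_of_pos_of_neg <;> linarith
      · apply mul_neg_of_neg_of_pos <;> linarith
      · apply mul_neg_of_pos_of_neg <;> linarith
      · apply mul_neg_of_neg_of_pos <;> linarith
    have hne : ((7350 - 147*b + 147*b^2) + (2548 - 49*b + 49*b^2)*z)*((- 7794 + 153*b - 156*b^2) + (- 13340 +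
      262*b - 267*b^2)*z + (- 753 + 15*b - 15*b^2)*z^2 + (- 2462 + 52*b - 49*b^2)*z^3 + (- 2453 + 48*b
      - 47*b^2)*z^4) ≠ 0 := by
      intro h0
      rw [h0, mul_zero] at n1
      exact aux_ne b z hb h0 n1.symm
    have hxe := eq_div_of_mul_eq hne n1
    rw [hs] at hxe
    refine ⟨((- 26968816 + 529396*b - 539788*b^2) + (- 194874911 + 3825381*b - 3900473*b^2)*s + (- 375289285 + 7366905*b - 7511515*b^2)*s^2 + (- 250790575 + 4923030*b - 5019640*b^2)*s^3 + (- 88517471 + 1737687*b - 1771704*b^2)*s^4 + (- 27610226 + 542675*b - 552597*b^2)*s^5 + (- 6500536 + 127694*b - 129903*b^2)*s^6)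
      / (((7350 - 147*b + 147*b^2) + (2548 - 49*b + 49*b^2)*s)*((- 7794 + 153*b - 156*b^2) + (- 13340 +
      262*b - 267*b^2)*s + (- 753 + 15*b - 15*b^2)*s^2 + (- 2462 + 52*b - 49*b^2)*s^3 + (- 2453 + 48*b
      - 47*b^2)*s^4)), s, ?_, hs⟩
    rw [hxe]
    push_cast
    rfl

theorem caseB (b : ℝ) (hb' : b^3 + 49*b + 49 = 0) (x z w a₁ a₂ a₃ a₄ a₅ : ℂ)
    (ha₁ : a₁ = -(12/343)*(b : ℂ)^2 - (384/343)*(b : ℂ) - 8/7)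
    (ha₂ : a₂ = -(32/343)*(b : ℂ)^2 + (24/343)*(b : ℂ) - 4)
    (ha₃ : a₃ = -(4/49)*(b : ℂ)^2 + (24/343)*(b : ℂ) - 4)
    (ha₄ : a₄ = -(8/343)*(b : ℂ)^2 + (8/343)*(b : ℂ) - 8/7)
    (ha₅ : a₅ = (b : ℂ)^2 - b + 50)
    (hQ : a₁*z^3 + a₂*z^2*w + a₃*z*w^2 + a₄*w^3 + (z + w)*x^2 ≠ 0)
    (h1 : a₅*(a₁*z^3 + a₂*z^2*w + a₃*z*w^2 + a₄*w^3 + (z + w)*x^2)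
      + 2*(z + a₅*w)*(a₂*z^2 + 2*a₃*z*w + 3*a₄*w^2 + x^2) = 0)
    (h : x = 0 ∨ (7*(x^2 + 2*x*z - 4*z^2)*
          (a₁*z^3 + a₂*z^2*w + a₃*z*w^2 + a₄*w^3 + (z + w)*x^2)
        = 4*(z + w)*(x - z)*(x^3 + 4*x^2*z - 4*x*z^2 - 8*z^3) ∧
      49*(x^2 + 2*x*z - 4*z^2)^2 = 16*(z + w)^2*(x - z)*(z + a₅*w))) :
    RealPt x z w := by
  obtain ⟨hb1, hb2, hb3, hb4⟩ := b_bounds b hb'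
  have hb : (b : ℂ)^3 + 49*b + 49 = 0 := by exact_mod_cast congrArg Complex.ofReal hb'
  have e1 : x^2*((7350 - 147*b + 147*b^2)*z^0*w^1 + (2548 - 49*b + 49*b^2)*z^1*w^0) = (20384 - 400*b +
      408*b^2)*z^0*w^3 + (51156 - 1004*b + 1024*b^2)*z^1*w^2 + (31360 - 612*b + 628*b^2)*z^2*w^1 +
      (588 - 8*b + 12*b^2)*z^3*w^0 := by
    rw [ha₁, ha₂, ha₃, ha₄, ha₅] at h1
    linear_combination 49*h1 + ((12/7)*b^1*x^0*z^3*w^0 + (96/7)*b^1*x^0*z^2*w^1 + (20)*b^1*x^0*z^1*w^2 + (8)*b^1*x^0*z^0*w^3 +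
      (372/7)*b^0*x^0*z^3*w^0 + (-24)*b^0*x^0*z^2*w^1 + (-260/7)*b^0*x^0*z^1*w^2 +
      (-16)*b^0*x^0*z^0*w^3)*hb
  by_cases hw : w = 0
  · subst hw
    have hz : z ≠ 0 := by
      rintro rfl
      apply hQ
      ring
    obtain ⟨c, rfl⟩ : ∃ c, x = c*z := ⟨x/z, by field_simp⟩
    have hz3 : z^3 ≠ 0 := pow_ne_zero 3 hz
    have hc : c^2*(2548 - 49*(b : ℂ) + 49*(b : ℂ)^2) = 588 - 8*(b : ℂ) + 12*(b : ℂ)^2 := by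
      apply mul_left_cancel₀ hz3
      linear_combination e1
    have hd : 0 < 2548 - 49*b + 49*b^2 := by linarith
    have hn : 0 < 588 - 8*b + 12*b^2 := by linarith
    have hdc : 2548 - 49*(b : ℂ) + 49*(b : ℂ)^2 ≠ 0 := by
      intro h0
      apply hd.ne'
      apply Complex.ofReal_injective
      push_cast
      exact h0
    have hsq : c^2 = ((Real.sqrt ((588 - 8*b + 12*b^2)/(2548 - 49*b + 49*b^2)) : ℝ) : ℂ)^2 := by
      rw [← Complex.ofReal_pow, Real.sq_sqrt (div_pos hn hd).le]
      push_cast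
      exact eq_div_of_mul_eq hdc hc
    have : ∃ r : ℝ, c = r := by
      rcases sq_eq_sq_iff_eq_or_eq_neg.1 hsq with h | h
      · exact ⟨_, h⟩
      · exact ⟨-_, by rw [h]; push_cast; rfl⟩
    obtain ⟨r, rfl⟩ := this
    refine ⟨z⁻¹, inv_ne_zero hz, r, 1, 0, ?_, ?_, ?_⟩
    · field_simp
    · simp [hz]
    · simp
  · obtain ⟨X, rfl⟩ : ∃ X, x = X*w := ⟨x/w, by field_simp⟩
    obtain ⟨Z, rfl⟩ : ∃ Z, z = Z*w := ⟨z/w, by field_simp⟩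
    obtain ⟨r, s, rfl, rfl⟩ := caseB_affine b hb' X Z a₁ a₂ a₃ a₄ a₅ ha₁ ha₂ ha₃ ha₄ ha₅ (by
        apply mul_left_cancel₀ (pow_ne_zero 3 hw)
        linear_combination e1) (by
        rcases h with h | ⟨E2, E3⟩
        · left; exact (mul_eq_zero.1 h).resolve_right hw
        · right
          constructor
          · apply mul_left_cancel₀ (pow_ne_zero 5 hw)
            linear_combination E2
          · apply mul_left_cancel₀ (pow_ne_zero 4 hw)
            linear_combination E3)
    refine ⟨w⁻¹, inv_ne_zero hw, r, s, 1, ?_, ?_, ?_⟩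
    · field_simp
    · field_simp
    · simp [hw]

theorem planar (b : ℝ) (hb' : b^3 + 49*b + 49 = 0) (x z w a₁ a₂ a₃ a₄ a₅ : ℂ)
    (ha₁ : a₁ = -(12/343)*(b : ℂ)^2 - (384/343)*(b : ℂ) - 8/7)
    (ha₂ : a₂ = -(32/343)*(b : ℂ)^2 + (24/343)*(b : ℂ) - 4)
    (ha₃ : a₃ = -(4/49)*(b : ℂ)^2 + (24/343)*(b : ℂ) - 4)
    (ha₄ : a₄ = -(8/343)*(b : ℂ)^2 + (8/343)*(b : ℂ) - 8/7)
    (ha₅ : a₅ = (b : ℂ)^2 - b + 50) (h0 : ¬ (x = 0 ∧ z = 0 ∧ w = 0)) (Q : ℂ)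
    (hQ : Q = a₁*z^3 + a₂*z^2*w + a₃*z*w^2 + a₄*w^3 + (z + w)*x^2)
    (hx : 7*x^6 + 42*z*x^5 - 224*z^3*x^3 + 224*z^5*x - 4*x*(z + w)*(z + a₅*w)*Q = 0)
    (hz : 7*x^6 - 168*z^2*x^4 + 560*z^4*x^2 - 448*z^6 - Q^2
      - 2*(z + a₅*w)*Q*(3*a₁*z^2 + 2*a₂*z*w + a₃*w^2 + x^2) = 0)
    (hw : a₅*Q^2 + 2*(z + a₅*w)*Q*(a₂*z^2 + 2*a₃*z*w + 3*a₄*w^2 + x^2) = 0) :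
    RealPt x z w := by
  obtain ⟨hb1, hb2, hb3, hb4⟩ := b_bounds b hb'
  have h5 : a₅ ≠ 0 := by
    intro h
    have : b^2 - b + 50 = 0 := by
      apply Complex.ofReal_injective
      push_cast
      rw [← ha₅]; exact h
    linarith
  rcases planar_struct a₁ a₂ a₃ a₄ a₅ x z w h5 _ _ Q _ rfl rfl hQ rfl
    (by linear_combination hx) hz (by linear_combination hw) with ⟨h1, h2⟩ | ⟨h1, h2, h3⟩
  · exact caseA b hb' x z w a₁ a₂ a₃ a₄ ha₁ ha₂ ha₃ ha₄ h0 h1 (by rw [← hQ]; exact h2)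
  · rw [hQ] at h1 h2 h3
    exact caseB b hb' x z w a₁ a₂ a₃ a₄ a₅ ha₁ ha₂ ha₃ ha₄ ha₅ h1 h2 h3

/-- Reduction of a singular point to the plane `y = 0` by the (real) seven-fold rotation. -/
theorem spatial (b : ℝ) (hb' : b^3 + 49*b + 49 = 0) (x y z w a₁ a₂ a₃ a₄ a₅ : ℂ)
    (ha₁ : a₁ = -(12/343)*(b : ℂ)^2 - (384/343)*(b : ℂ) - 8/7)
    (ha₂ : a₂ = -(32/343)*(b : ℂ)^2 + (24/343)*(b : ℂ) - 4)
    (ha₃ : a₃ = -(4/49)*(b : ℂ)^2 + (24/343)*(b : ℂ) - 4)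
    (ha₄ : a₄ = -(8/343)*(b : ℂ)^2 + (8/343)*(b : ℂ) - 8/7)
    (ha₅ : a₅ = (b : ℂ)^2 - b + 50) (h0 : ¬ (x = 0 ∧ y = 0 ∧ z = 0 ∧ w = 0)) (Q r g : ℂ)
    (hr : r = x^2 + y^2)
    (hQ : Q = a₁*z^3 + a₂*z^2*w + a₃*z*w^2 + a₄*w^3 + (z + w)*r)
    (hg : g = 7*z*(3*r^2 - 16*z^2*r + 16*z^4) - 2*(z + a₅*w)*Q*(z + w))
    (hx : 7*x^6 - 105*x^4*y^2 + 105*x^2*y^4 - 7*y^6 + 2*x*g = 0)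
    (hy : -42*x^5*y + 140*x^3*y^3 - 42*x*y^5 + 2*y*g = 0)
    (hz : 7*r^3 - 168*z^2*r^2 + 560*z^4*r - 448*z^6 - Q^2
      - 2*(z + a₅*w)*Q*(3*a₁*z^2 + 2*a₂*z*w + a₃*w^2 + r) = 0)
    (hw : a₅*Q^2 + 2*(z + a₅*w)*Q*(a₂*z^2 + 2*a₃*z*w + 3*a₄*w^2 + r) = 0) :
    ∃ l : ℂ, l ≠ 0 ∧ ∃ p q s t : ℝ, l * x = p ∧ l * y = q ∧ l * z = s ∧ l * w = t := by
  have hI : Complex.I^2 = -1 := Complex.I_sq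
  obtain ⟨u, hu⟩ : ∃ u, u = x + Complex.I*y := ⟨_, rfl⟩
  obtain ⟨v, hv⟩ : ∃ v, v = x - Complex.I*y := ⟨_, rfl⟩
  have huv : u*v = r := by
    rw [hu, hv, hr]; linear_combination -y^2*hI
  have hxuv : x = (u + v)/2 := by rw [hu, hv]; ring
  have hyuv : y = -Complex.I*(u - v)/2 := by
    rw [hu, hv]; linear_combination y*hI
  have h4 : Complex.I^4 = 1 := Complex.I_pow_four
  have h3 : Complex.I^3 = -Complex.I := Complex.I_pow_three
  have h5 : Complex.I^5 = Complex.I := by rw [pow_succ, h4, one_mul]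
  have h6 : Complex.I^6 = -1 := by rw [show 6 = 4 + 2 from rfl, pow_add, h4, hI, one_mul]
  have d1 : 7*u^6 + 2*v*g = 0 := by
    rw [hu, hv]
    ring_nf
    rw [hI, h3, h4, h5, h6]
    linear_combination hx - Complex.I*hy
  have d2 : 7*v^6 + 2*u*g = 0 := by
    rw [hu, hv]
    ring_nf
    rw [hI, h3, h4, h5, h6]
    linear_combination hx + Complex.I*hy
  by_cases hu0 : u = 0
  · have hv0 : v = 0 := by
      rw [hu0] at d2
      have : v^6 = 0 := by linear_combination d2/7
      exact pow_eq_zero_iff (by norm_num) |>.1 this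
    have hx0 : x = 0 := by rw [hxuv, hu0, hv0]; ring
    have hy0 : y = 0 := by rw [hyuv, hu0, hv0]; ring
    have hr0 : r = 0 := by rw [← huv, hu0, zero_mul]
    rw [hr0] at hQ hz hw
    obtain ⟨l, hl, _, s, t, -, hs, ht⟩ := planar b hb' 0 z w a₁ a₂ a₃ a₄ a₅ ha₁ ha₂ ha₃ ha₄ ha₅
      (fun h => h0 ⟨hx0, hy0, h.2.1, h.2.2⟩) Q (by rw [hQ]; ring) (by ring)
      (by linear_combination hz) (by linear_combination hw)
    exact ⟨l, hl, 0, 0, s, t, by simp [hx0], by simp [hy0], hs, ht⟩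
  · have hv0 : v ≠ 0 := by
      intro hv0
      rw [hv0] at d1
      have : u^6 = 0 := by linear_combination d1/7
      exact hu0 (pow_eq_zero_iff (by norm_num) |>.1 this)
    have h7 : u^7 = v^7 := by linear_combination (u*d1 - v*d2)/7
    obtain ⟨e, he⟩ : ∃ e, e = v/u := ⟨_, rfl⟩
    have hve : v = e*u := by rw [he]; field_simp
    have he7 : e^7 = 1 := by
      rw [he, div_pow, h7, div_self (pow_ne_zero 7 hv0)]
    have he0 : e ≠ 0 := by rintro rfl; simp at he7
    obtain ⟨c, hc⟩ : ∃ c, c = e^4*u := ⟨_, rfl⟩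
    have hc0 : c ≠ 0 := by rw [hc]; exact mul_ne_zero (pow_ne_zero 4 he0) hu0
    have hcr : c^2 = r := by
      rw [← huv, hc, hve]; linear_combination e*u^2*he7
    have hc7 : c^7 = u^7 := by
      rw [hc]
      linear_combination u^7*((e^7)^3 + (e^7)^2 + e^7 + 1)*he7
    have hcx : 7*c^6 + 2*c*g = 0 := by
      apply mul_left_cancel₀ hc0
      linear_combination u*d1 + 7*hc7 - 2*g*huv + 2*g*hcr
    rw [← hcr] at hQ hg hz hw
    obtain ⟨l, hl, p, s, t, hp, hs, ht⟩ := planar b hb' c z w a₁ a₂ a₃ a₄ a₅ ha₁ ha₂ ha₃ ha₄ ha₅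
      (fun h => hc0 h.1) Q hQ (by rw [hg] at hcx; linear_combination hcx)
      (by linear_combination hz) (by linear_combination hw)
    have huc : u = e^3*c := by rw [hc]; linear_combination -u*he7
    have hvc : v = e^4*c := by rw [hve, hc]; linear_combination -e*u*he7
    have hnorm : ‖e‖ = 1 := by
      have := congrArg norm he7
      rw [norm_pow, norm_one] at this
      exact (pow_eq_one_iff_of_nonneg (norm_nonneg e) (by norm_num)).1 this
    have hnorm3 : ‖e^3‖ = 1 := by rw [norm_pow, hnorm, one_pow]
    have hconj : e^4 = (starRingEnd ℂ) (e^3) := by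
      have h1 : e^3 * (starRingEnd ℂ) (e^3) = 1 := by
        rw [Complex.mul_conj, Complex.normSq_eq_norm_sq, hnorm3]; simp
      apply mul_left_cancel₀ (pow_ne_zero 3 he0)
      rw [h1]; linear_combination he7
    have hadd := Complex.add_conj (e^3)
    have hsub := Complex.sub_conj (e^3)
    refine ⟨l, hl, p*(e^3).re, p*(e^3).im, s, t, ?_, ?_, hs, ht⟩
    · rw [hxuv, huc, hvc, hconj]
      push_cast at hadd ⊢
      linear_combination c*l/2*hadd + ((e^3).re : ℂ)*hp
    · rw [hyuv, huc, hvc, hconj]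
      push_cast at hsub ⊢
      linear_combination -Complex.I*c*l/2*hsub + ((e^3).im : ℂ)*hp - ((e^3).im : ℂ)*l*c*hI

/-- For the unique real root α_ℝ of 7α³ + 7α + 1 = 0 and the
parameters of the theorem, every singular point of {S_{α_ℝ} = 0} ⊂ ℙ³(ℂ) can be
represented by a nonzero vector with real coordinates. -/
theorem septic_99_nodes_all_real (αR : ℝ)
    (hα : 7 * αR ^ 3 + 7 * αR + 1 = 0)
    (a₁ a₂ a₃ a₄ a₅ : ℂ)
    (ha₁ : a₁ = -(12 / 7) * (αR : ℂ) ^ 2 - (384 / 49) * (αR : ℂ) - 8 / 7)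
    (ha₂ : a₂ = -(32 / 7) * (αR : ℂ) ^ 2 + (24 / 49) * (αR : ℂ) - 4)
    (ha₃ : a₃ = -4 * (αR : ℂ) ^ 2 + (24 / 49) * (αR : ℂ) - 4)
    (ha₄ : a₄ = -(8 / 7) * (αR : ℂ) ^ 2 + (8 / 49) * (αR : ℂ) - 8 / 7)
    (ha₅ : a₅ = 49 * (αR : ℂ) ^ 2 - 7 * (αR : ℂ) + 50)
    (S : MvPolynomial (Fin 4) ℂ) (hS : S = Psept - Usept a₁ a₂ a₃ a₄ a₅) :
    ∀ p : Projectivization ℂ (Fin 4 → ℂ), IsSingularPoint S p →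
      ∃ v : Fin 4 → ℂ, ∃ hv : v ≠ 0, Projectivization.mk ℂ v hv = p ∧
        ∀ i, ∃ r : ℝ, v i = (r : ℂ) := by
  rintro p ⟨v, hv, hp, hJ⟩
  have k0 := hJ 0
  have k1 := hJ 1
  have k2 := hJ 2
  have k3 := hJ 3
  have d7 : ∀ i, pderiv i (7 : MvPolynomial (Fin 4) ℂ) = 0 := fun i => pderiv_C (a := 7)
  have d8 : ∀ i, pderiv i (8 : MvPolynomial (Fin 4) ℂ) = 0 := fun i => pderiv_C (a := 8)
  have d16 : ∀ i, pderiv i (16 : MvPolynomial (Fin 4) ℂ) = 0 := fun i => pderiv_C (a := 16)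
  have d21 : ∀ i, pderiv i (21 : MvPolynomial (Fin 4) ℂ) = 0 := fun i => pderiv_C (a := 21)
  have d35 : ∀ i, pderiv i (35 : MvPolynomial (Fin 4) ℂ) = 0 := fun i => pderiv_C (a := 35)
  have d64 : ∀ i, pderiv i (64 : MvPolynomial (Fin 4) ℂ) = 0 := fun i => pderiv_C (a := 64)
  rw [hS, Psept, Usept] at k0 k1 k2 k3
  simp only [map_add, map_sub, Derivation.leibniz, Derivation.leibniz_pow, pderiv_C, pderiv_X,
    d7, d8, d16, d21, d35, d64,
    smul_eq_mul, map_mul, map_pow, eval_X, eval_C, mul_zero, zero_add, add_zero, map_zero,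
    nsmul_eq_mul, map_natCast, Pi.single_apply, Fin.reduceEq, if_true, if_false, map_one,
    mul_one, Nat.cast_ofNat, map_ofNat, Nat.reduceSub, pow_one] at k0 k1 k2 k3
  obtain ⟨l, hl, p', q', s', t', h0, h1, h2, h3⟩ := spatial (7*αR) (by linear_combination 49*hα)
    (v 0) (v 1) (v 2) (v 3) a₁ a₂ a₃ a₄ a₅ (by rw [ha₁]; push_cast; ring)
    (by rw [ha₂]; push_cast; ring) (by rw [ha₃]; push_cast; ring) (by rw [ha₄]; push_cast; ring)
    (by rw [ha₅]; push_cast; ring)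
    (fun h => hv (by
      funext i
      fin_cases i
      · exact h.1
      · exact h.2.1
      · exact h.2.2.1
      · exact h.2.2.2)) _ _ _ rfl rfl rfl
    (by linear_combination k0) (by linear_combination k1) (by linear_combination k2)
    (by linear_combination -k3)
  refine ⟨l • v, smul_ne_zero hl hv, ?_, ?_⟩
  · rw [← hp, Projectivization.mk_eq_mk_iff']
    exact ⟨l, rfl⟩
  · intro i
    fin_cases i
    · exact ⟨p', h0⟩
    · exact ⟨q', h1⟩
    · exact ⟨s', h2⟩
    · exact ⟨t', h3⟩
end

section
/- There exists a homogeneous polynomial F of degree 7 in ℝ[x,y,z,w] such that the surface {F = 0} in ℙ³(ℂ) has exactly 99 singular points, every singular point is a node (ordinary double point), and every singular point can be represented by a nonzero vector with real coordinates. In particular, the maximum number μ^ℝ(7) of real nodes on a real septic surface in ℙ³ satisfies μ^ℝ(7) ≥ 99. -/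
open MvPolynomial

/-- The Hessian matrix `(∂²F/∂xᵢ∂xⱼ)(v)`. -/
noncomputable def hessianAt (F : MvPolynomial (Fin 4) ℂ) (v : Fin 4 → ℂ) :
    Matrix (Fin 4) (Fin 4) ℂ :=
  Matrix.of fun i j => eval v (pderiv i (pderiv j F))

/-- A point of ℙ³(ℂ) is a node of `{F = 0}` if it is represented by a nonzero
vector at which all partial derivatives of `F` vanish and the 4×4 Hessian
matrix has rank 3. -/
def IsNode (F : MvPolynomial (Fin 4) ℂ)
    (p : Projectivization ℂ (Fin 4 → ℂ)) : Prop :=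
  ∃ v : Fin 4 → ℂ, ∃ hv : v ≠ 0, Projectivization.mk ℂ v hv = p ∧
    VanishingJacobianAt F v ∧ (hessianAt F v).rank = 3

/-- A point of ℙ³(ℂ) is real, i.e. representable by a nonzero vector with real
coordinates. -/
def IsRealPoint (p : Projectivization ℂ (Fin 4 → ℂ)) : Prop :=
  ∃ v : Fin 4 → ℂ, ∃ hv : v ≠ 0, Projectivization.mk ℂ v hv = p ∧
    ∀ i, ∃ r : ℝ, v i = (r : ℂ)


set_option linter.unusedSimpArgs false

namespace Septic

/-- The septic, over an arbitrary commutative ring. It is `P + (z + w) q ^ 2` with `P` the product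
of seven planes through a regular heptagon and `q` a dihedrally invariant cubic. -/
noncomputable def poly (K : Type) [CommRing K] : MvPolynomial (Fin 4) K :=
  X 0 ^ 7 + C (-21) * (X 0 ^ 5 * X 1 ^ 2) + C 35 * (X 0 ^ 3 * X 1 ^ 4) + C (-7) * (X 0 * X 1 ^ 6)
  + C 7 * (X 2 * (X 0 ^ 2 + X 1 ^ 2) ^ 3) + C (-56) * (X 2 ^ 3 * (X 0 ^ 2 + X 1 ^ 2) ^ 2)
  + C 112 * (X 2 ^ 5 * (X 0 ^ 2 + X 1 ^ 2)) + C (-64) * X 2 ^ 7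
  + (X 2 + X 3) * (C 7 * (X 3 * (X 0 ^ 2 + X 1 ^ 2)) + C (-8) * X 2 ^ 3
      + C 4 * (X 2 ^ 2 * X 3) + C 4 * (X 2 * X 3 ^ 2) + C (-8) * X 3 ^ 3) ^ 2

lemma map_poly : MvPolynomial.map (algebraMap ℝ ℂ) (poly ℝ) = poly ℂ := by
  simp [poly]

lemma poly_homogeneous : (poly ℝ).IsHomogeneous 7 := by
  have hX (i : Fin 4) : (X i : MvPolynomial (Fin 4) ℝ).IsHomogeneous 1 := isHomogeneous_X _ _
  have hP (i : Fin 4) (n : ℕ) : (X i ^ n : MvPolynomial (Fin 4) ℝ).IsHomogeneous n := by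
    simpa using (hX i).pow n
  have hr : (X 0 ^ 2 + X 1 ^ 2 : MvPolynomial (Fin 4) ℝ).IsHomogeneous 2 := (hP 0 2).add (hP 1 2)
  have hq : (C 7 * (X 3 * (X 0 ^ 2 + X 1 ^ 2)) + C (-8) * X 2 ^ 3
      + C 4 * (X 2 ^ 2 * X 3) + C 4 * (X 2 * X 3 ^ 2) + C (-8) * X 3 ^ 3 :
        MvPolynomial (Fin 4) ℝ).IsHomogeneous 3 :=
    (((((hX 3).mul hr).C_mul 7).add ((hP 2 3).C_mul (-8))).add (((hP 2 2).mul (hX 3)).C_mul 4)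
      |>.add (((hX 2).mul (hP 3 2)).C_mul 4)).add ((hP 3 3).C_mul (-8))
  unfold poly
  exact (((((((hP 0 7).add (((hP 0 5).mul (hP 1 2)).C_mul (-21))).add
    (((hP 0 3).mul (hP 1 4)).C_mul 35)).add (((hX 0).mul (hP 1 6)).C_mul (-7))).add
    (((hX 2).mul (hr.pow 3)).C_mul 7)).add (((hP 2 3).mul (hr.pow 2)).C_mul (-56))).add
    (((hP 2 5).mul hr).C_mul 112)).add ((hP 2 7).C_mul (-64)) |>.add
    (((hX 2).add (hX 3)).mul (hq.pow 2))

/-! The invariant part `G(r, z, w)`, `r = x² + y²`, through its partial derivatives. -/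

def q (r z w : ℂ) : ℂ := 7 * w * r - 8 * z ^ 3 + 4 * z ^ 2 * w + 4 * z * w ^ 2 - 8 * w ^ 3
def qz (z w : ℂ) : ℂ := -24 * z ^ 2 + 8 * z * w + 4 * w ^ 2
def qw (r z w : ℂ) : ℂ := 7 * r + 4 * z ^ 2 + 8 * z * w - 24 * w ^ 2
def Gr (r z w : ℂ) : ℂ :=
  21 * z * r ^ 2 - 112 * z ^ 3 * r + 112 * z ^ 5 + 14 * w * (z + w) * q r z w
def Gz (r z w : ℂ) : ℂ :=
  7 * r ^ 3 - 168 * z ^ 2 * r ^ 2 + 560 * z ^ 4 * r - 448 * z ^ 6 + q r z w ^ 2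
    + 2 * (z + w) * q r z w * qz z w
def Gw (r z w : ℂ) : ℂ := q r z w ^ 2 + 2 * (z + w) * q r z w * qw r z w
def Grr (r z w : ℂ) : ℂ := 42 * z * r - 112 * z ^ 3 + 98 * w ^ 2 * (z + w)
def Grz (r z w : ℂ) : ℂ :=
  21 * r ^ 2 - 336 * z ^ 2 * r + 560 * z ^ 4 + 14 * w * q r z w + 14 * w * (z + w) * qz z w
def Grw (r z w : ℂ) : ℂ := 14 * (z + 2 * w) * q r z w + 14 * w * (z + w) * qw r z w
def Gzz (r z w : ℂ) : ℂ :=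
  -336 * z * r ^ 2 + 2240 * z ^ 3 * r - 2688 * z ^ 5 + 4 * q r z w * qz z w
    + 2 * (z + w) * (qz z w ^ 2 + q r z w * (-48 * z + 8 * w))
def Gzw (r z w : ℂ) : ℂ :=
  2 * q r z w * qw r z w + 2 * q r z w * qz z w
    + 2 * (z + w) * (qw r z w * qz z w + q r z w * (8 * z + 8 * w))
def Gww (r z w : ℂ) : ℂ :=
  4 * q r z w * qw r z w + 2 * (z + w) * (qw r z w ^ 2 + q r z w * (8 * z - 48 * w))

lemma d0 (v : Fin 4 → ℂ) : eval v (pderiv 0 (poly ℂ)) =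
    7 * (v 0 ^ 6 - 15 * v 0 ^ 4 * v 1 ^ 2 + 15 * v 0 ^ 2 * v 1 ^ 4 - v 1 ^ 6)
      + 2 * v 0 * Gr (v 0 ^ 2 + v 1 ^ 2) (v 2) (v 3) := by
  simp [poly, pderiv_X, Gr, q]
  ring

lemma d1 (v : Fin 4 → ℂ) : eval v (pderiv 1 (poly ℂ)) =
    -7 * (6 * v 0 ^ 5 * v 1 - 20 * v 0 ^ 3 * v 1 ^ 3 + 6 * v 0 * v 1 ^ 5)
      + 2 * v 1 * Gr (v 0 ^ 2 + v 1 ^ 2) (v 2) (v 3) := by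
  simp [poly, pderiv_X, Gr, q]
  ring

lemma d2 (v : Fin 4 → ℂ) : eval v (pderiv 2 (poly ℂ)) =
    Gz (v 0 ^ 2 + v 1 ^ 2) (v 2) (v 3) := by
  simp [poly, pderiv_X, Gz, q, qz]
  ring

lemma d3 (v : Fin 4 → ℂ) : eval v (pderiv 3 (poly ℂ)) =
    Gw (v 0 ^ 2 + v 1 ^ 2) (v 2) (v 3) := by
  simp [poly, pderiv_X, Gw, q, qw]
  ring

lemma pd_ofNat (i : Fin 4) (n : ℕ) [n.AtLeastTwo] :
    pderiv i (ofNat(n) : MvPolynomial (Fin 4) ℂ) = 0 :=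
  (pderiv i).map_natCast n

lemma h00 (v : Fin 4 → ℂ) : eval v (pderiv 0 (pderiv 0 (poly ℂ))) =
    42 * (v 0 ^ 5 - 10 * v 0 ^ 3 * v 1 ^ 2 + 5 * v 0 * v 1 ^ 4) + 2 * Gr (v 0 ^ 2 + v 1 ^ 2) (v 2) (v 3) + 4 * v 0 ^ 2 * Grr (v 0 ^ 2 + v 1 ^ 2) (v 2) (v 3) := by
  simp [poly, pderiv_X, pd_ofNat, Gr, Grr, Grz, Grw, Gzz, Gzw, Gww, q, qz, qw]
  ring

lemma h01 (v : Fin 4 → ℂ) : eval v (pderiv 0 (pderiv 1 (poly ℂ))) =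
    -42 * (5 * v 0 ^ 4 * v 1 - 10 * v 0 ^ 2 * v 1 ^ 3 + v 1 ^ 5) + 4 * v 0 * v 1 * Grr (v 0 ^ 2 + v 1 ^ 2) (v 2) (v 3) := by
  simp [poly, pderiv_X, pd_ofNat, Gr, Grr, Grz, Grw, Gzz, Gzw, Gww, q, qz, qw]
  ring

lemma h02 (v : Fin 4 → ℂ) : eval v (pderiv 0 (pderiv 2 (poly ℂ))) =
    2 * v 0 * Grz (v 0 ^ 2 + v 1 ^ 2) (v 2) (v 3) := by
  simp [poly, pderiv_X, pd_ofNat, Gr, Grr, Grz, Grw, Gzz, Gzw, Gww, q, qz, qw]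
  ring

lemma h03 (v : Fin 4 → ℂ) : eval v (pderiv 0 (pderiv 3 (poly ℂ))) =
    2 * v 0 * Grw (v 0 ^ 2 + v 1 ^ 2) (v 2) (v 3) := by
  simp [poly, pderiv_X, pd_ofNat, Gr, Grr, Grz, Grw, Gzz, Gzw, Gww, q, qz, qw]
  ring

lemma h10 (v : Fin 4 → ℂ) : eval v (pderiv 1 (pderiv 0 (poly ℂ))) =
    -42 * (5 * v 0 ^ 4 * v 1 - 10 * v 0 ^ 2 * v 1 ^ 3 + v 1 ^ 5) + 4 * v 0 * v 1 * Grr (v 0 ^ 2 + v 1 ^ 2) (v 2) (v 3) := by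
  simp [poly, pderiv_X, pd_ofNat, Gr, Grr, Grz, Grw, Gzz, Gzw, Gww, q, qz, qw]
  ring

lemma h11 (v : Fin 4 → ℂ) : eval v (pderiv 1 (pderiv 1 (poly ℂ))) =
    -42 * (v 0 ^ 5 - 10 * v 0 ^ 3 * v 1 ^ 2 + 5 * v 0 * v 1 ^ 4) + 2 * Gr (v 0 ^ 2 + v 1 ^ 2) (v 2) (v 3) + 4 * v 1 ^ 2 * Grr (v 0 ^ 2 + v 1 ^ 2) (v 2) (v 3) := by
  simp [poly, pderiv_X, pd_ofNat, Gr, Grr, Grz, Grw, Gzz, Gzw, Gww, q, qz, qw]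
  ring

lemma h12 (v : Fin 4 → ℂ) : eval v (pderiv 1 (pderiv 2 (poly ℂ))) =
    2 * v 1 * Grz (v 0 ^ 2 + v 1 ^ 2) (v 2) (v 3) := by
  simp [poly, pderiv_X, pd_ofNat, Gr, Grr, Grz, Grw, Gzz, Gzw, Gww, q, qz, qw]
  ring

lemma h13 (v : Fin 4 → ℂ) : eval v (pderiv 1 (pderiv 3 (poly ℂ))) =
    2 * v 1 * Grw (v 0 ^ 2 + v 1 ^ 2) (v 2) (v 3) := by
  simp [poly, pderiv_X, pd_ofNat, Gr, Grr, Grz, Grw, Gzz, Gzw, Gww, q, qz, qw]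
  ring

lemma h20 (v : Fin 4 → ℂ) : eval v (pderiv 2 (pderiv 0 (poly ℂ))) =
    2 * v 0 * Grz (v 0 ^ 2 + v 1 ^ 2) (v 2) (v 3) := by
  simp [poly, pderiv_X, pd_ofNat, Gr, Grr, Grz, Grw, Gzz, Gzw, Gww, q, qz, qw]
  ring

lemma h21 (v : Fin 4 → ℂ) : eval v (pderiv 2 (pderiv 1 (poly ℂ))) =
    2 * v 1 * Grz (v 0 ^ 2 + v 1 ^ 2) (v 2) (v 3) := by
  simp [poly, pderiv_X, pd_ofNat, Gr, Grr, Grz, Grw, Gzz, Gzw, Gww, q, qz, qw]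
  ring

lemma h22 (v : Fin 4 → ℂ) : eval v (pderiv 2 (pderiv 2 (poly ℂ))) =
    Gzz (v 0 ^ 2 + v 1 ^ 2) (v 2) (v 3) := by
  simp [poly, pderiv_X, pd_ofNat, Gr, Grr, Grz, Grw, Gzz, Gzw, Gww, q, qz, qw]
  ring

lemma h23 (v : Fin 4 → ℂ) : eval v (pderiv 2 (pderiv 3 (poly ℂ))) =
    Gzw (v 0 ^ 2 + v 1 ^ 2) (v 2) (v 3) := by
  simp [poly, pderiv_X, pd_ofNat, Gr, Grr, Grz, Grw, Gzz, Gzw, Gww, q, qz, qw]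
  ring

lemma h30 (v : Fin 4 → ℂ) : eval v (pderiv 3 (pderiv 0 (poly ℂ))) =
    2 * v 0 * Grw (v 0 ^ 2 + v 1 ^ 2) (v 2) (v 3) := by
  simp [poly, pderiv_X, pd_ofNat, Gr, Grr, Grz, Grw, Gzz, Gzw, Gww, q, qz, qw]
  ring

lemma h31 (v : Fin 4 → ℂ) : eval v (pderiv 3 (pderiv 1 (poly ℂ))) =
    2 * v 1 * Grw (v 0 ^ 2 + v 1 ^ 2) (v 2) (v 3) := by
  simp [poly, pderiv_X, pd_ofNat, Gr, Grr, Grz, Grw, Gzz, Gzw, Gww, q, qz, qw]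
  ring

lemma h32 (v : Fin 4 → ℂ) : eval v (pderiv 3 (pderiv 2 (poly ℂ))) =
    Gzw (v 0 ^ 2 + v 1 ^ 2) (v 2) (v 3) := by
  simp [poly, pderiv_X, pd_ofNat, Gr, Grr, Grz, Grw, Gzz, Gzw, Gww, q, qz, qw]
  ring

lemma h33 (v : Fin 4 → ℂ) : eval v (pderiv 3 (pderiv 3 (poly ℂ))) =
    Gww (v 0 ^ 2 + v 1 ^ 2) (v 2) (v 3) := by
  simp [poly, pderiv_X, pd_ofNat, Gr, Grr, Grz, Grw, Gzz, Gzw, Gww, q, qz, qw]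
  ring


lemma rank_three (H : Matrix (Fin 4) (Fin 4) ℂ) (v : Fin 4 → ℂ) (hv : v ≠ 0)
    (hk : H.mulVec v = 0) (hu : ∀ n, H.mulVec n = 0 → ∃ c : ℂ, c • v = n) : H.rank = 3 := by
  have h1 : Module.finrank ℂ (LinearMap.ker H.mulVecLin) = 1 := by
    rw [finrank_eq_one_iff']
    refine ⟨⟨v, by simpa using hk⟩, ?_, ?_⟩
    · intro h
      exact hv (congrArg Subtype.val h)
    · rintro ⟨n, hn⟩
      obtain ⟨c, hc⟩ := hu n (by simpa using hn)
      exact ⟨c, Subtype.ext hc⟩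
  have h2 := LinearMap.finrank_range_add_finrank_ker H.mulVecLin
  rw [h1] at h2
  simp at h2
  unfold Matrix.rank
  omega

lemma jac_iff (v : Fin 4 → ℂ) : VanishingJacobianAt (poly ℂ) v ↔
    (7 * (v 0 ^ 6 - 15 * v 0 ^ 4 * v 1 ^ 2 + 15 * v 0 ^ 2 * v 1 ^ 4 - v 1 ^ 6)
      + 2 * v 0 * Gr (v 0 ^ 2 + v 1 ^ 2) (v 2) (v 3) = 0 ∧
    -7 * (6 * v 0 ^ 5 * v 1 - 20 * v 0 ^ 3 * v 1 ^ 3 + 6 * v 0 * v 1 ^ 5)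
      + 2 * v 1 * Gr (v 0 ^ 2 + v 1 ^ 2) (v 2) (v 3) = 0 ∧
    Gz (v 0 ^ 2 + v 1 ^ 2) (v 2) (v 3) = 0 ∧ Gw (v 0 ^ 2 + v 1 ^ 2) (v 2) (v 3) = 0) := by
  rw [← d0, ← d1, ← d2, ← d3]
  unfold VanishingJacobianAt
  constructor
  · intro h
    exact ⟨h 0, h 1, h 2, h 3⟩
  · rintro ⟨a, b, c, d⟩ i
    fin_cases i
    exacts [a, b, c, d]

lemma hess_row (v n : Fin 4 → ℂ) (i : Fin 4) : (hessianAt (poly ℂ) v).mulVec n i =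
    eval v (pderiv i (pderiv 0 (poly ℂ))) * n 0 + eval v (pderiv i (pderiv 1 (poly ℂ))) * n 1 +
    eval v (pderiv i (pderiv 2 (poly ℂ))) * n 2 + eval v (pderiv i (pderiv 3 (poly ℂ))) * n 3 := by
  simp [hessianAt, Matrix.mulVec, dotProduct, Fin.sum_univ_four]

lemma euler (v : Fin 4 → ℂ) (h : VanishingJacobianAt (poly ℂ) v) :
    (hessianAt (poly ℂ) v).mulVec v = 0 := by
  obtain ⟨e0, e1, e2, e3⟩ := (jac_iff v).1 h
  ext i
  rw [hess_row]
  fin_cases i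
  · simp only [Fin.zero_eta, h00, h01, h02, h03, Pi.zero_apply]
    simp only [Gr, Grr, Grz, Grw, q, qz, qw] at e0 ⊢
    linear_combination 6 * e0
  · simp only [Fin.mk_one, h10, h11, h12, h13, Pi.zero_apply]
    simp only [Gr, Grr, Grz, Grw, q, qz, qw] at e1 ⊢
    linear_combination 6 * e1
  · simp only [Fin.reduceFinMk, h20, h21, h22, h23, Pi.zero_apply]
    simp only [Gz, Gzz, Gzw, Grz, Grw, q, qz, qw] at e2 ⊢
    linear_combination 6 * e2
  · simp only [Fin.reduceFinMk, h30, h31, h32, h33, Pi.zero_apply]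
    simp only [Gw, Gww, Gzw, Grz, Grw, q, qz, qw] at e3 ⊢
    linear_combination 6 * e3

/-- Singular points of the plane section off the axis, normalised by `x = 1`. -/
def PlaneSing (z w : ℂ) : Prop := 7 + 2 * Gr 1 z w = 0 ∧ Gz 1 z w = 0 ∧ Gw 1 z w = 0

lemma c5s5 (x y : ℂ) (hr : x ^ 2 + y ^ 2 = 1)
    (h7 : (x + y * Complex.I) ^ 7 = 1) (h7' : (x - y * Complex.I) ^ 7 = 1) :
    x ^ 6 - 15 * x ^ 4 * y ^ 2 + 15 * x ^ 2 * y ^ 4 - y ^ 6 = x ∧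
    6 * x ^ 5 * y - 20 * x ^ 3 * y ^ 3 + 6 * x * y ^ 5 = -y ∧
    x ^ 5 - 10 * x ^ 3 * y ^ 2 + 5 * x * y ^ 4 = x ^ 2 - y ^ 2 ∧
    5 * x ^ 4 * y - 10 * x ^ 2 * y ^ 3 + y ^ 5 = -2 * x * y := by
  have hI := Complex.I_sq
  set u := x + y * Complex.I with hu
  set v := x - y * Complex.I with hv
  have huv : u * v = 1 := by rw [hu, hv]; linear_combination hr - y ^ 2 * hI
  have u6 : u ^ 6 = v := by linear_combination v * h7 - u ^ 6 * huv
  have v6 : v ^ 6 = u := by linear_combination u * h7' - v ^ 6 * huv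
  have u5 : u ^ 5 = v ^ 2 := by linear_combination v * u6 - u ^ 5 * huv
  have v5 : v ^ 5 = u ^ 2 := by linear_combination u * v6 - v ^ 5 * huv
  have hI3 : Complex.I ^ 3 = - Complex.I := by linear_combination Complex.I * hI
  have hI4 : Complex.I ^ 4 = 1 := by linear_combination (Complex.I ^ 2 - 1) * hI
  have hI5 : Complex.I ^ 5 = Complex.I := by linear_combination Complex.I * hI4
  have hI6 : Complex.I ^ 6 = -1 := by linear_combination Complex.I ^ 2 * hI4 + hI
  have hx : 2 * x = u + v := by rw [hu, hv]; ring
  have hI0 : Complex.I ≠ 0 := Complex.I_ne_zero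
  refine ⟨?_, ?_, ?_, ?_⟩
  · have : u ^ 6 + v ^ 6 = u + v := by rw [u6, v6]; ring
    rw [hu, hv] at this
    ring_nf at this
    simp only [hI, hI4, hI6] at this
    linear_combination this / 2
  · have : u ^ 6 - v ^ 6 = v - u := by rw [u6, v6]
    rw [hu, hv] at this
    ring_nf at this
    simp only [hI3, hI5] at this
    apply mul_left_cancel₀ hI0
    linear_combination this / 2
  · have : u ^ 5 + v ^ 5 = u ^ 2 + v ^ 2 := by rw [u5, v5]; ring
    rw [hu, hv] at this
    ring_nf at this
    simp only [hI, hI4] at this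
    linear_combination this / 2
  · have : u ^ 5 - v ^ 5 = v ^ 2 - u ^ 2 := by rw [u5, v5]
    rw [hu, hv] at this
    ring_nf at this
    simp only [hI3, hI5] at this
    apply mul_left_cancel₀ hI0
    linear_combination this / 2

/-- A rotated plane singularity is a singularity of the surface. -/
lemma sing_of_plane (v : Fin 4 → ℂ) (hr : v 0 ^ 2 + v 1 ^ 2 = 1)
    (h7 : (v 0 + v 1 * Complex.I) ^ 7 = 1) (h7' : (v 0 - v 1 * Complex.I) ^ 7 = 1)
    (h : PlaneSing (v 2) (v 3)) : VanishingJacobianAt (poly ℂ) v := by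
  obtain ⟨e1, e2, e3⟩ := h
  obtain ⟨c6, s6, -, -⟩ := c5s5 _ _ hr h7 h7'
  rw [jac_iff, hr]
  refine ⟨?_, ?_, e2, e3⟩
  · linear_combination 7 * c6 + v 0 * e1
  · linear_combination -7 * s6 + v 1 * e1

lemma node_of_plane (v : Fin 4 → ℂ) (hr : v 0 ^ 2 + v 1 ^ 2 = 1)
    (h7 : (v 0 + v 1 * Complex.I) ^ 7 = 1) (h7' : (v 0 - v 1 * Complex.I) ^ 7 = 1)
    (h : PlaneSing (v 2) (v 3))
    (hD : Gzz 1 (v 2) (v 3) * Gww 1 (v 2) (v 3) - Gzw 1 (v 2) (v 3) ^ 2 ≠ 0) :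
    (hessianAt (poly ℂ) v).rank = 3 := by
  have hs := sing_of_plane v hr h7 h7' h
  have hv : v ≠ 0 := by
    rintro rfl
    simp at hr
  have he := euler v hs
  refine rank_three _ v hv he fun n hn => ?_
  have r0 := (hess_row v n 0).symm.trans (congrFun hn 0)
  have r1 := (hess_row v n 1).symm.trans (congrFun hn 1)
  have r2 := (hess_row v n 2).symm.trans (congrFun hn 2)
  have r3 := (hess_row v n 3).symm.trans (congrFun hn 3)
  have t2 := (hess_row v v 2).symm.trans (congrFun he 2)
  have t3 := (hess_row v v 3).symm.trans (congrFun he 3)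
  obtain ⟨-, -, c5, s5⟩ := c5s5 _ _ hr h7 h7'
  obtain ⟨e1, -, -⟩ := h
  simp only [h00, h01, h02, h03, Pi.zero_apply, hr, c5, s5] at r0
  simp only [h10, h11, h12, h13, Pi.zero_apply, hr, c5, s5] at r1
  simp only [h20, h21, h22, h23, Pi.zero_apply, hr] at r2 t2
  simp only [h30, h31, h32, h33, Pi.zero_apply, hr] at r3 t3
  set gr := Gr 1 (v 2) (v 3)
  set grr := Grr 1 (v 2) (v 3)
  set gzz := Gzz 1 (v 2) (v 3)
  set gzw := Gzw 1 (v 2) (v 3)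
  set gww := Gww 1 (v 2) (v 3)
  set grz := Grz 1 (v 2) (v 3)
  set grw := Grw 1 (v 2) (v 3)
  have ht : v 0 * n 1 = v 1 * n 0 := by
    have : 49 * (v 0 * n 1 - v 1 * n 0) = 0 := by
      linear_combination v 1 * r0 - v 0 * r1 +
        (-42 * (v 0 * n 1 - v 1 * n 0)) * hr + (v 0 * n 1 - v 1 * n 0) * e1
    have := (mul_eq_zero.1 this).resolve_left (by norm_num)
    linear_combination this
  set m := v 0 * n 0 + v 1 * n 1 with hm
  have f2 : gzz * (n 2 - m * v 2) + gzw * (n 3 - m * v 3) = 0 := by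
    linear_combination r2 - m * t2 + (2 * m * grz) * hr
  have f3 : gzw * (n 2 - m * v 2) + gww * (n 3 - m * v 3) = 0 := by
    linear_combination r3 - m * t3 + (2 * m * grw) * hr
  have n2 : n 2 - m * v 2 = 0 := by
    refine (mul_eq_zero.1 (?_ : (gzz * gww - gzw ^ 2) * _ = 0)).resolve_left hD
    linear_combination gww * f2 - gzw * f3
  have n3 : n 3 - m * v 3 = 0 := by
    refine (mul_eq_zero.1 (?_ : (gzz * gww - gzw ^ 2) * _ = 0)).resolve_left hD
    linear_combination gzz * f3 - gzw * f2
  refine ⟨m, ?_⟩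
  ext i
  fin_cases i
  · simp only [Fin.zero_eta, Pi.smul_apply, smul_eq_mul]
    linear_combination v 0 * hm + v 1 * ht + n 0 * hr
  · simp only [Fin.mk_one, Pi.smul_apply, smul_eq_mul]
    linear_combination v 1 * hm - v 0 * ht + n 1 * hr
  · simp only [Fin.reduceFinMk, Pi.smul_apply, smul_eq_mul]
    linear_combination -n2
  · simp only [Fin.reduceFinMk, Pi.smul_apply, smul_eq_mul]
    linear_combination -n3


/-- The Hessian determinant of the plane section in the `z, w` directions. -/
def dD (z w : ℂ) : ℂ := Gzz 1 z w * Gww 1 z w - Gzw 1 z w ^ 2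

lemma sing_t1 (z : ℂ) (hc : 8 * z ^ 3 + 4 * z ^ 2 - 4 * z - 1 = 0) :
    PlaneSing (z) (- 1) := by
  simp only [PlaneSing, Gr, Gz, Gw, q, qz, qw]
  refine ⟨?_, ?_, ?_⟩
  · linear_combination (28 * z ^ 2 + 14 * z - 35) * hc
  · linear_combination (0) * hc
  · linear_combination (28 * z ^ 2 + 14 * z - 35) * hc

lemma dD_t1 (z : ℂ) (hc : 8 * z ^ 3 + 4 * z ^ 2 - 4 * z - 1 = 0) :
    dD (z) (- 1) ≠ 0 := by
  intro h
  simp only [dD, Gzz, Gzw, Gww, q, qz, qw] at h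
  have h1 : (1 : ℂ) = 0 := by
    linear_combination (31/4036081 * z ^ 2 - 34/4036081 * z - 151/4036081) * h -
      (- 99200/82369 * z ^ 7 - 320/82369 * z ^ 6 + 17632/2009 * z ^ 5 + 495104/82369 * z ^ 4 - 729544/82369 * z ^ 3 - 425984/82369 * z ^ 2 + 203108/82369 * z + 33445/82369) * hc
  exact one_ne_zero h1

lemma sing_t2 (z : ℂ) (hc : 8 * z ^ 3 + 4 * z ^ 2 - 4 * z - 1 = 0) :
    PlaneSing (z) (- 2 * z ^ 2 + 1) := by
  simp only [PlaneSing, Gr, Gz, Gw, q, qz, qw]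
  refine ⟨?_, ?_, ?_⟩
  · linear_combination (896 * z ^ 7 - 672 * z ^ 6 - 1680 * z ^ 5 + 1008 * z ^ 4 + 1008 * z ^ 3 - 364 * z ^ 2 - 210 * z + 21) * hc
  · linear_combination (896 * z ^ 8 + 224 * z ^ 7 - 2352 * z ^ 6 - 336 * z ^ 5 + 1708 * z ^ 4 + 112 * z ^ 3 - 252 * z ^ 2) * hc
  · linear_combination (3584 * z ^ 9 - 1792 * z ^ 8 - 9184 * z ^ 7 + 3696 * z ^ 6 + 8064 * z ^ 5 - 2380 * z ^ 4 - 2716 * z ^ 3 + 504 * z ^ 2 + 266 * z - 35) * hc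

lemma dD_t2 (z : ℂ) (hc : 8 * z ^ 3 + 4 * z ^ 2 - 4 * z - 1 = 0) :
    dD (z) (- 2 * z ^ 2 + 1) ≠ 0 := by
  intro h
  simp only [dD, Gzz, Gzw, Gww, q, qz, qw] at h
  have h1 : (1 : ℂ) = 0 := by
    linear_combination (- 37/405769 * z ^ 2 + 57/811538 * z + 153/1623076) * h -
      (58195968/8281 * z ^ 19 + 13369344/8281 * z ^ 18 - 465076224/8281 * z ^ 17 - 17399808/8281 * z ^ 16 + 1408319488/8281 * z ^ 15 - 46694400/8281 * z ^ 14 - 2188996608/8281 * z ^ 13 + 121037824/8281 * z ^ 12 + 1929311232/8281 * z ^ 11 - 112790016/8281 * z ^ 10 - 75703296/637 * z ^ 9 + 60117952/8281 * z ^ 8 + 280423040/8281 * z ^ 7 - 3247232/1183 * z ^ 6 - 40268136/8281 * z ^ 5 + 5748644/8281 * z ^ 4 + 2206544/8281 * z ^ 3 - 708712/8281 * z ^ 2 + 14666/8281 * z + 20674/8281) * hc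
  exact one_ne_zero h1

lemma sing_t3 (z : ℂ) (hc : 8 * z ^ 3 + 4 * z ^ 2 - 4 * z - 1 = 0) :
    PlaneSing (z) (2 * z ^ 2 + 1/2 * z) := by
  simp only [PlaneSing, Gr, Gz, Gw, q, qz, qw]
  refine ⟨?_, ?_, ?_⟩
  · linear_combination (- 896 * z ^ 7 - 896 * z ^ 6 - 560 * z ^ 5 - 392 * z ^ 4 - 147/2 * z ^ 3 + 28 * z ^ 2 - 14 * z - 7) * hc
  · linear_combination (- 896 * z ^ 8 + 112 * z ^ 6 - 112 * z ^ 5 + 385/2 * z ^ 4 - 105 * z ^ 3 + 63/4 * z ^ 2 + 28 * z - 7) * hc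
  · linear_combination (3584 * z ^ 9 + 3584 * z ^ 8 + 2240 * z ^ 7 + 1568 * z ^ 6 - 42 * z ^ 5 - 196 * z ^ 4 - 147 * z ^ 3 - 343/4 * z ^ 2) * hc

lemma dD_t3 (z : ℂ) (hc : 8 * z ^ 3 + 4 * z ^ 2 - 4 * z - 1 = 0) :
    dD (z) (2 * z ^ 2 + 1/2 * z) ≠ 0 := by
  intro h
  simp only [dD, Gzz, Gzw, Gww, q, qz, qw] at h
  have h1 : (1 : ℂ) = 0 := by
    linear_combination (956808/682097689 * z ^ 2 + 270020/682097689 * z - 528466/682097689) * h -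
      (- 1504928858112/13920361 * z ^ 19 - 1177169166336/13920361 * z ^ 18 + 2876246065152/13920361 * z ^ 17 + 526612168704/1988623 * z ^ 16 + 1961530392576/13920361 * z ^ 15 + 301178847232/13920361 * z ^ 14 - 34681315328/339521 * z ^ 13 - 838618716160/13920361 * z ^ 12 + 2559733184/1988623 * z ^ 11 - 1370963648/13920361 * z ^ 10 + 108152258720/13920361 * z ^ 9 + 14032616880/13920361 * z ^ 8 - 38486035188/13920361 * z ^ 7 + 9520046262/13920361 * z ^ 6 + 4224758208/13920361 * z ^ 5 + 2522664672/13920361 * z ^ 4 + 79830012/1988623 * z ^ 3 - 6981434/152971 * z ^ 2 - 4 * z + 1) * hc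
  exact one_ne_zero h1

lemma sing_t4 (z : ℂ) (hc : 8 * z ^ 3 + 4 * z ^ 2 - 4 * z - 1 = 0) :
    PlaneSing (- 2 * z ^ 2 - z + 1) (- 2 * z ^ 2 + 1) := by
  simp only [PlaneSing, Gr, Gz, Gw, q, qz, qw]
  refine ⟨?_, ?_, ?_⟩
  · linear_combination (896 * z ^ 7 - 896 * z ^ 6 - 2128 * z ^ 5 + 1008 * z ^ 4 + 1344 * z ^ 3 - 280 * z ^ 2 - 238 * z + 7) * hc
  · linear_combination (- 1792 * z ^ 8 - 2464 * z ^ 7 + 3024 * z ^ 6 + 3696 * z ^ 5 - 1652 * z ^ 4 - 1232 * z ^ 3 + 420 * z ^ 2) * hc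
  · linear_combination (3584 * z ^ 9 - 7840 * z ^ 7 - 560 * z ^ 6 + 5824 * z ^ 5 + 588 * z ^ 4 - 1988 * z ^ 3 - 168 * z ^ 2 + 294 * z - 21) * hc

lemma dD_t4 (z : ℂ) (hc : 8 * z ^ 3 + 4 * z ^ 2 - 4 * z - 1 = 0) :
    dD (- 2 * z ^ 2 - z + 1) (- 2 * z ^ 2 + 1) ≠ 0 := by
  intro h
  simp only [dD, Gzz, Gzw, Gww, q, qz, qw] at h
  have h1 : (1 : ℂ) = 0 := by
    linear_combination (- 5/8281 * z ^ 2 - 3/8281 * z - 3/115934) * h -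
      (15728640/169 * z ^ 19 + 60555264/169 * z ^ 18 - 55836672/1183 * z ^ 17 - 1471021056/1183 * z ^ 16 - 543604736/1183 * z ^ 15 + 2114994176/1183 * z ^ 14 + 151963648/169 * z ^ 13 - 230743040/169 * z ^ 12 - 840638464/1183 * z ^ 11 + 712012032/1183 * z ^ 10 + 25153152/91 * z ^ 9 - 185952576/1183 * z ^ 8 - 58562240/1183 * z ^ 7 + 28663536/1183 * z ^ 6 + 2438256/1183 * z ^ 5 - 2446856/1183 * z ^ 4 + 31832/91 * z ^ 3 + 87344/1183 * z ^ 2 - 232/13 * z - 167/1183) * hc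
  exact one_ne_zero h1

lemma sing_t5 (z : ℂ) (hc : 4 * z ^ 2 + 2 * z - 5 = 0) :
    PlaneSing (z) (- 1) := by
  simp only [PlaneSing, Gr, Gz, Gw, q, qz, qw]
  refine ⟨?_, ?_, ?_⟩
  · linear_combination (56 * z ^ 3 + 28 * z ^ 2 - 28 * z - 7) * hc
  · linear_combination (0) * hc
  · linear_combination (56 * z ^ 3 + 28 * z ^ 2 - 28 * z - 7) * hc

lemma dD_t5 (z : ℂ) (hc : 4 * z ^ 2 + 2 * z - 5 = 0) :
    dD (z) (- 1) ≠ 0 := by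
  intro h
  simp only [dD, Gzz, Gzw, Gww, q, qz, qw] at h
  have h1 : (1 : ℂ) = 0 := by
    linear_combination (- 5/1153166 * z - 61/6918996) * h -
      (16000/11767 * z ^ 7 + 150400/35301 * z ^ 6 + 2080/861 * z ^ 5 - 10768/5043 * z ^ 4 - 55376/35301 * z ^ 3 + 15220/35301 * z ^ 2 + 2990/11767 * z + 2024/11767) * hc
  exact one_ne_zero h1

/-- All singular points of the plane section off the axis. -/
lemma plane_complete (z w : ℂ) (h : PlaneSing z w) :
    (8 * z ^ 3 + 4 * z ^ 2 - 4 * z - 1 = 0 ∧ (w = -1 ∨ w = 1 - 2 * z ^ 2 ∨ w = 2 * z ^ 2 + z / 2)) ∨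
    (w = -1 ∧ 4 * z ^ 2 + 2 * z - 5 = 0) ∨
    ∃ t, 8 * t ^ 3 + 4 * t ^ 2 - 4 * t - 1 = 0 ∧ z = 1 - t - 2 * t ^ 2 ∧ w = 1 - 2 * t ^ 2 := by
  obtain ⟨hx, hz, hw⟩ := h
  simp only [Gr, Gz, Gw] at hx hz hw
  by_cases hq : q 1 z w = 0
  · left
    rw [hq] at hx hz
    have hc : 8 * z ^ 3 + 4 * z ^ 2 - 4 * z - 1 = 0 := by
      linear_combination (4 * z ^ 2 - 1) * hx / 7 + (2 * z) * hz / 7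
    refine ⟨hc, ?_⟩
    have hp : (w + 1) * ((w - (1 - 2 * z ^ 2)) * (w - (2 * z ^ 2 + z / 2))) = 0 := by
      simp only [q] at hq
      linear_combination -hq / 8 + (- 4 * z * w - 4 * z + w) / 8 * hc
    rcases mul_eq_zero.1 hp with h | h
    · left; linear_combination h
    · rcases mul_eq_zero.1 h with h | h
      · right; left; linear_combination h
      · right; right; linear_combination h
  · right
    have hh : q 1 z w + 2 * (z + w) * qw 1 z w = 0 := by
      refine (mul_eq_zero.1 (?_ : q 1 z w * _ = 0)).resolve_left hq
      linear_combination hw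
    set c := 8 * z ^ 3 + 4 * z ^ 2 - 4 * z - 1 with hcdef
    set d := 4 * z ^ 2 - 2 * z - 1 with hddef
    have e4 : c * d + 4 * w * (z + w) * q 1 z w = 0 := by
      rw [hcdef, hddef]
      linear_combination hx / 7
    have hf : (1 - z) * c ^ 2 + (z + w) * q 1 z w ^ 2 = 0 := by
      rw [hcdef]
      simp only [q, qz, qw] at hx hz hw ⊢
      linear_combination (hx + z * hz + w * hw) / 7
    have hc : c ≠ 0 := by
      intro hc
      rw [hc] at hf
      have hB : z + w = 0 := by
        have : (z + w) * q 1 z w ^ 2 = 0 := by linear_combination hf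
        exact (mul_eq_zero.1 this).resolve_right (pow_ne_zero 2 hq)
      apply hq
      linear_combination hh - 2 * qw 1 z w * hB
    have e3 : d * q 1 z w - 4 * w * (1 - z) * c = 0 := by
      refine (mul_eq_zero.1 (?_ : c * _ = 0)).resolve_left hc
      linear_combination q 1 z w * e4 - 4 * w * hf
    have e1 : 16 * w ^ 2 * (z + w) * (z - 1) - d ^ 2 = 0 := by
      refine (mul_eq_zero.1 (?_ : c * _ = 0)).resolve_left hc
      linear_combination -d * e4 + 4 * w * (z + w) * e3
    rw [hcdef, hddef] at e3 e4
    rw [hddef] at e1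
    simp only [q, qw] at hh e3 e4
    have k1 : 8 * w ^ 2 + 2 * w - 4 * z ^ 2 - 2 * z - 1 = 0 := by
      linear_combination (172/15 * z ^ 2 + 352/15 * z * w ^ 2 - 94/15 * z * w - 43/15 * z - 88/15 * w ^ 3 + 172/15 * w ^ 2 - 23/15 * w - 59/30) * e1
        + (- 352/105 * z ^ 3 * w - 44/105 * z ^ 3 + 352/35 * z ^ 2 * w ^ 2 + 16/15 * z ^ 2 * w - 128/105 * z ^ 2 - 176/105 * z * w ^ 3 - 92/35 * z * w ^ 2 - 4/15 * z * w + 26/105 * z - 176/21 * w ^ 4 + 352/105 * w ^ 3 + 274/105 * w ^ 2 - 107/105 * w + 5/14) * hh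
        + (- 17/3 * z - 131/15 * w + 41/30) * e3
        + (1/15 * z + 44/3 * w ^ 2 - 44/15 * w - 89/30) * e4
    have k2 : (w + 1) * (w - 1 + 2 * (w - z) ^ 2) = 0 := by
      linear_combination (16/3 * z ^ 2 + 40/3 * z * w ^ 2 - 23/6 * z * w - 19/12 * z - 10/3 * w ^ 3 + 16/3 * w ^ 2 - 23/12 * w + 25/24) * e1
        + (- 40/21 * z ^ 3 * w - 23/21 * z ^ 3 + 40/7 * z ^ 2 * w ^ 2 + 22/21 * z ^ 2 * w + 1/21 * z ^ 2 - 20/21 * z * w ^ 3 - z * w ^ 2 - 16/21 * z * w + 8/21 * z - 100/21 * w ^ 4 + 58/21 * w ^ 3 + 5/6 * w ^ 2 - 83/84 * w + 15/56) * hh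
        + (- 49/12 * z - 83/12 * w + 35/24) * e3
        + (- 17/12 * z + 25/3 * w ^ 2 - 19/6 * w + 1/24) * e4
    have k3 : (w + 1) * (8 * (w - z) ^ 3 + 4 * (w - z) ^ 2 - 4 * (w - z) - 1) = 0 := by
      linear_combination (64/15 * z ^ 2 + 544/15 * z * w ^ 2 - 73/15 * z * w - 167/30 * z - 136/15 * w ^ 3 + 304/15 * w ^ 2 - 97/30 * w + 239/60) * e1
        + (- 544/105 * z ^ 3 * w - 638/105 * z ^ 3 + 544/35 * z ^ 2 * w ^ 2 + 484/105 * z ^ 2 * w + 304/105 * z ^ 2 - 272/105 * z * w ^ 3 + 46/35 * z * w ^ 2 - 346/105 * z * w + 137/105 * z - 272/21 * w ^ 4 + 664/105 * w ^ 3 - 107/105 * w ^ 2 - 523/210 * w + 9/28) * hh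
        + (- 61/6 * z - 499/30 * w + 169/60) * e3
        + (- 241/30 * z + 68/3 * w ^ 2 - 98/15 * w + 179/60) * e4
    by_cases h1 : w + 1 = 0
    · left
      have hw1 : w = -1 := by linear_combination h1
      refine ⟨hw1, ?_⟩
      rw [hw1] at k1
      linear_combination -k1
    · right
      have k2' := (mul_eq_zero.1 k2).resolve_left h1
      have k3' := (mul_eq_zero.1 k3).resolve_left h1
      exact ⟨w - z, k3', by linear_combination k2', by linear_combination k2'⟩

/-- Singular points on the axis. -/
lemma axis_complete (z w : ℂ) (hz : Gz 0 z w = 0) (hw : Gw 0 z w = 0) : w = 0 := by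
  simp only [Gz, Gw] at hz hw
  by_cases hq : q 0 z w = 0
  · rw [hq] at hz
    have hz0 : z = 0 := by
      have : z ^ 6 = 0 := by linear_combination -hz / 448
      exact pow_eq_zero_iff (by norm_num) |>.1 this
    rw [hz0] at hq
    simp only [q] at hq
    have : w ^ 3 = 0 := by linear_combination -hq / 8
    exact pow_eq_zero_iff (by norm_num) |>.1 this
  · have hh : q 0 z w + 2 * (z + w) * qw 0 z w = 0 := by
      refine (mul_eq_zero.1 (?_ : q 0 z w * _ = 0)).resolve_left hq
      linear_combination hw
    have h2 : w * ((z - 2 * w) * (z + w)) = 0 := by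
      simp only [q, qw] at hh
      linear_combination hh / 28
    rcases mul_eq_zero.1 h2 with h | h
    · exact h
    · rcases mul_eq_zero.1 h with h | h
      · have hz2 : z = 2 * w := by linear_combination h
        rw [hz2] at hz
        simp only [q, qz] at hz
        have : w ^ 6 = 0 := by linear_combination hz / (-4480)
        exact pow_eq_zero_iff (by norm_num) |>.1 this
      · exfalso
        apply hq
        have hz2 : z = -w := by linear_combination h
        rw [hz2]
        simp only [q]
        ring


lemma axis_sing : VanishingJacobianAt (poly ℂ) ![0, 0, 1, 0] := by
  rw [jac_iff]
  simp [Gr, Gz, Gw, q, qz, qw]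
  norm_num

lemma axis_node : (hessianAt (poly ℂ) ![0, 0, 1, 0]).rank = 3 := by
  refine rank_three _ _ ?_ (euler _ axis_sing) fun n hn => ?_
  · intro h
    simpa using congrFun h 2
  · have r0 := (hess_row _ n 0).symm.trans (congrFun hn 0)
    have r1 := (hess_row _ n 1).symm.trans (congrFun hn 1)
    have r3 := (hess_row _ n 3).symm.trans (congrFun hn 3)
    simp [h00, h01, h02, h03, Gr, Grr, q] at r0
    simp [h10, h11, h12, h13, Gr, Grr, q] at r1
    simp only [h30, h31, h32, h33, Gzw, Gww, q, qz, qw, Pi.zero_apply] at r3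
    simp at r3
    have n3 : n 3 = 0 := by linear_combination r3 / (-224)
    refine ⟨n 2, ?_⟩
    ext i
    fin_cases i <;> simp [r0, r1, n3]

/-- A real root of the cubic of `cos (2 π / 7)`. -/
lemma exists_root : ∃ a : ℝ, 0.6234 < a ∧ a < 0.6235 ∧ 8 * a ^ 3 + 4 * a ^ 2 - 4 * a - 1 = 0 := by
  have hcont : ContinuousOn (fun x : ℝ => 8 * x ^ 3 + 4 * x ^ 2 - 4 * x - 1)
      (Set.Icc 0.6234 0.6235) := by fun_prop
  have h := intermediate_value_Ioo (by norm_num) hcont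
  obtain ⟨a, ha, h0⟩ := h (show (0 : ℝ) ∈ _ by constructor <;> norm_num)
  exact ⟨a, ha.1, ha.2, h0⟩

set_option maxHeartbeats 2000000 in
lemma exists_plane_points : ∃ pz pw : Fin 14 → ℝ,
    Function.Injective (fun j => (pz j, pw j)) ∧
    (∀ j, PlaneSing (pz j) (pw j)) ∧ (∀ j, dD (pz j) (pw j) ≠ 0) ∧
    ∀ z w : ℂ, PlaneSing z w → ∃ j, (pz j : ℂ) = z ∧ (pw j : ℂ) = w := by
  obtain ⟨a, ha1, ha2, ha⟩ := exists_root
  obtain ⟨b, hb⟩ : ∃ b, b = 2 * a ^ 2 - 1 := ⟨_, rfl⟩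
  obtain ⟨c, hc⟩ : ∃ c, c = 1 / 2 - a - 2 * a ^ 2 := ⟨_, rfl⟩
  obtain ⟨s, hs, hs0⟩ : ∃ s : ℝ, s ^ 2 = 21 ∧ 0 ≤ s :=
    ⟨√21, Real.sq_sqrt (by norm_num), Real.sqrt_nonneg _⟩
  have hb0 : 8 * b ^ 3 + 4 * b ^ 2 - 4 * b - 1 = 0 := by
    rw [hb]
    linear_combination (8 * a ^ 3 - 4 * a ^ 2 - 4 * a + 1) * ha
  have hc0 : 8 * c ^ 3 + 4 * c ^ 2 - 4 * c - 1 = 0 := by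
    rw [hc]
    linear_combination (-8 * a ^ 3 - 8 * a ^ 2 + 2 * a + 1) * ha
  have qa1 : 0.3886 < a ^ 2 := by nlinarith
  have qa2 : a ^ 2 < 0.3888 := by nlinarith
  have hb1 : -0.2228 < b := by linarith
  have hb2 : b < -0.2224 := by linarith
  have hc1 : -0.9011 < c := by linarith
  have hc2 : c < -0.9006 := by linarith
  have qb1 : 0.0494 < b ^ 2 := by nlinarith
  have qb2 : b ^ 2 < 0.0497 := by nlinarith
  have qc1 : 0.811 < c ^ 2 := by nlinarith
  have qc2 : c ^ 2 < 0.812 := by nlinarith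
  have hs1 : 4.58 < s := by nlinarith
  have hs2 : s < 4.59 := by nlinarith
  have haC : 8 * (a : ℂ) ^ 3 + 4 * (a : ℂ) ^ 2 - 4 * a - 1 = 0 := by exact_mod_cast ha
  have hbC : 8 * (b : ℂ) ^ 3 + 4 * (b : ℂ) ^ 2 - 4 * b - 1 = 0 := by exact_mod_cast hb0
  have hcC : 8 * (c : ℂ) ^ 3 + 4 * (c : ℂ) ^ 2 - 4 * c - 1 = 0 := by exact_mod_cast hc0
  have hsC : (s : ℂ) ^ 2 = 21 := by exact_mod_cast hs
  have hbC' : (b : ℂ) = 2 * a ^ 2 - 1 := by rw [hb]; push_cast; ring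
  have hcC' : (c : ℂ) = 1 / 2 - a - 2 * a ^ 2 := by rw [hc]; push_cast; ring
  have hsp : 4 * ((-1 + (s : ℂ)) / 4) ^ 2 + 2 * ((-1 + (s : ℂ)) / 4) - 5 = 0 := by
    linear_combination hsC / 4
  have hsm : 4 * ((-1 - (s : ℂ)) / 4) ^ 2 + 2 * ((-1 - (s : ℂ)) / 4) - 5 = 0 := by
    linear_combination hsC / 4
  have roots (z : ℂ) (hz : 8 * z ^ 3 + 4 * z ^ 2 - 4 * z - 1 = 0) : z = a ∨ z = b ∨ z = c := by
    have : (z - a) * ((z - b) * (z - c)) = 0 := by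
      rw [hbC', hcC']
      linear_combination hz / 8 + (-(a : ℂ) / 2 * z + a ^ 2 / 2 - 1 / 8) * haC
    rcases mul_eq_zero.1 this with h | h
    · left; linear_combination h
    · rcases mul_eq_zero.1 h with h | h
      · right; left; linear_combination h
      · right; right; linear_combination h
  refine ⟨![(-1 - s) / 4, c, b, a, (-1 + s) / 4, c, -2 * c ^ 2 - c + 1, b, -2 * a ^ 2 - a + 1, a, b,
      -2 * b ^ 2 - b + 1, c, a],
    ![-1, -1, -1, -1, -1, -2 * c ^ 2 + 1, -2 * c ^ 2 + 1, 2 * b ^ 2 + 1 / 2 * b, -2 * a ^ 2 + 1,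
      -2 * a ^ 2 + 1, -2 * b ^ 2 + 1, -2 * b ^ 2 + 1, 2 * c ^ 2 + 1 / 2 * c, 2 * a ^ 2 + 1 / 2 * a],
    ?_, ?_, ?_, ?_⟩
  · refine Function.Injective.of_comp (f := fun p : ℝ × ℝ => p.1 + 10 * p.2) ?_
    refine StrictMono.injective (Fin.strictMono_iff_lt_succ.2 fun i => ?_)
    fin_cases i <;> simp <;> linarith
  · intro j
    fin_cases j
    · simpa using sing_t5 _ hsm
    · simpa using sing_t1 _ hcC
    · simpa using sing_t1 _ hbC
    · simpa using sing_t1 _ haC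
    · simpa using sing_t5 _ hsp
    · simpa using sing_t2 _ hcC
    · simpa using sing_t4 _ hcC
    · simpa using sing_t3 _ hbC
    · simpa using sing_t4 _ haC
    · simpa using sing_t2 _ haC
    · simpa using sing_t2 _ hbC
    · simpa using sing_t4 _ hbC
    · simpa using sing_t3 _ hcC
    · simpa using sing_t3 _ haC
  · intro j
    fin_cases j
    · simpa using dD_t5 _ hsm
    · simpa using dD_t1 _ hcC
    · simpa using dD_t1 _ hbC
    · simpa using dD_t1 _ haC
    · simpa using dD_t5 _ hsp
    · simpa using dD_t2 _ hcC
    · simpa using dD_t4 _ hcC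
    · simpa using dD_t3 _ hbC
    · simpa using dD_t4 _ haC
    · simpa using dD_t2 _ haC
    · simpa using dD_t2 _ hbC
    · simpa using dD_t4 _ hbC
    · simpa using dD_t3 _ hcC
    · simpa using dD_t3 _ haC
  · intro z w h
    rcases plane_complete z w h with ⟨hz, hw⟩ | ⟨hw, hz⟩ | ⟨t, ht, hz, hw⟩
    · rcases roots z hz with rfl | rfl | rfl <;> rcases hw with rfl | rfl | rfl
      · exact ⟨3, by simp, by simp⟩
      · exact ⟨9, by simp, by simp; ring⟩
      · exact ⟨13, by simp, by simp; ring⟩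
      · exact ⟨2, by simp, by simp⟩
      · exact ⟨10, by simp, by simp; ring⟩
      · exact ⟨7, by simp, by simp; ring⟩
      · exact ⟨1, by simp, by simp⟩
      · exact ⟨5, by simp, by simp; ring⟩
      · exact ⟨12, by simp, by simp; ring⟩
    · subst hw
      have : (z - (-1 - s) / 4) * (z - (-1 + s) / 4) = 0 := by
        linear_combination hz / 4 - hsC / 16
      rcases mul_eq_zero.1 this with h | h
      · exact ⟨0, by simp; linear_combination -h, by simp⟩
      · exact ⟨4, by simp; linear_combination -h, by simp⟩
    · subst hz hw
      rcases roots t ht with rfl | rfl | rfl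
      · exact ⟨8, by simp; ring, by simp; ring⟩
      · exact ⟨11, by simp; ring, by simp; ring⟩
      · exact ⟨6, by simp; ring, by simp; ring⟩

/-- Every singular vector is on the axis or is a multiple of a rotated plane singularity. -/
lemma surface_complete (v : Fin 4 → ℂ) (h : VanishingJacobianAt (poly ℂ) v) :
    (v 0 = 0 ∧ v 1 = 0 ∧ v 3 = 0) ∨ ∃ t e z w : ℂ, e ^ 7 = 1 ∧ PlaneSing z w ∧
      v 0 + v 1 * Complex.I = t * e ∧ v 0 - v 1 * Complex.I = t * e⁻¹ ∧ v 2 = t * z ∧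
      v 3 = t * w := by
  obtain ⟨e0, e1, e2, e3⟩ := (jac_iff v).1 h
  have hI := Complex.I_sq
  obtain ⟨u, hu⟩ : ∃ u, u = v 0 + v 1 * Complex.I := ⟨_, rfl⟩
  obtain ⟨k, hk⟩ : ∃ k, k = v 0 - v 1 * Complex.I := ⟨_, rfl⟩
  have hx : v 0 = (u + k) / 2 := by rw [hu, hk]; ring
  have hy : v 1 = -(u - k) * Complex.I / 2 := by
    rw [hu, hk]; linear_combination v 1 * hI
  have hr : v 0 ^ 2 + v 1 ^ 2 = u * k := by
    rw [hu, hk]; linear_combination v 1 ^ 2 * hI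
  rw [hr] at e0 e1 e2 e3
  have hI3 : Complex.I ^ 3 = - Complex.I := by linear_combination Complex.I * hI
  have hI4 : Complex.I ^ 4 = 1 := by linear_combination (Complex.I ^ 2 - 1) * hI
  have hI5 : Complex.I ^ 5 = Complex.I := by linear_combination Complex.I * hI4
  have hI6 : Complex.I ^ 6 = -1 := by linear_combination Complex.I ^ 2 * hI4 + hI
  have hu6 : u ^ 6 = (v 0 ^ 6 - 15 * v 0 ^ 4 * v 1 ^ 2 + 15 * v 0 ^ 2 * v 1 ^ 4 - v 1 ^ 6) +
      Complex.I * (6 * v 0 ^ 5 * v 1 - 20 * v 0 ^ 3 * v 1 ^ 3 + 6 * v 0 * v 1 ^ 5) := by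
    rw [hu]
    ring_nf
    simp only [hI, hI3, hI4, hI5, hI6]
    ring
  have hk6 : k ^ 6 = (v 0 ^ 6 - 15 * v 0 ^ 4 * v 1 ^ 2 + 15 * v 0 ^ 2 * v 1 ^ 4 - v 1 ^ 6) -
      Complex.I * (6 * v 0 ^ 5 * v 1 - 20 * v 0 ^ 3 * v 1 ^ 3 + 6 * v 0 * v 1 ^ 5) := by
    rw [hk]
    ring_nf
    simp only [hI, hI3, hI4, hI5, hI6]
    ring
  have u6 : 7 * u ^ 6 + 2 * k * Gr (u * k) (v 2) (v 3) = 0 := by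
    generalize Gr (u * k) (v 2) (v 3) = g at e0 e1 ⊢
    rw [hu6, hk]
    linear_combination e0 - Complex.I * e1
  have k6 : 7 * k ^ 6 + 2 * u * Gr (u * k) (v 2) (v 3) = 0 := by
    generalize Gr (u * k) (v 2) (v 3) = g at e0 e1 ⊢
    rw [hk6, hu]
    linear_combination e0 + Complex.I * e1
  have huk : u = 0 ↔ k = 0 := by
    constructor
    · intro h0
      rw [h0] at k6
      have : k ^ 6 = 0 := by linear_combination k6 / 7
      exact pow_eq_zero_iff (by norm_num) |>.1 this
    · intro h0
      rw [h0] at u6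
      have : u ^ 6 = 0 := by linear_combination u6 / 7
      exact pow_eq_zero_iff (by norm_num) |>.1 this
  by_cases hu0 : u = 0
  · left
    have hk0 := huk.1 hu0
    rw [hu0, zero_mul] at e2 e3
    refine ⟨by rw [hx, hu0, hk0]; ring, by rw [hy, hu0, hk0]; ring, axis_complete _ _ e2 e3⟩
  · right
    have hk0 : k ≠ 0 := fun h => hu0 (huk.2 h)
    have h77 : (u / k) ^ 7 = 1 := by
      rw [div_pow, div_eq_one_iff_eq (pow_ne_zero 7 hk0)]
      linear_combination (u * u6 - k * k6) / 7
    obtain ⟨e, he⟩ : ∃ e, e = (u / k) ^ 4 := ⟨_, rfl⟩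
    have he7 : e ^ 7 = 1 := by
      rw [he, ← pow_mul, mul_comm, pow_mul, h77, one_pow]
    have he2 : e ^ 2 = u / k := by
      rw [he]
      linear_combination (u / k) * h77
    have he0 : e ≠ 0 := by
      intro h0
      rw [h0] at he7
      norm_num at he7
    obtain ⟨t, ht⟩ : ∃ t, t = u / e := ⟨_, rfl⟩
    have ht0 : t ≠ 0 := by rw [ht]; exact div_ne_zero hu0 he0
    have hut : u = t * e := by rw [ht]; field_simp
    have hkt : k = t * e⁻¹ := by
      have h1 : e ^ 2 * k = u := by rw [he2]; field_simp
      rw [ht]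
      field_simp
      linear_combination h1
    have huk2 : u * k = t ^ 2 := by
      rw [hut, hkt]
      field_simp
    obtain ⟨z, hz⟩ : ∃ z, z = v 2 / t := ⟨_, rfl⟩
    obtain ⟨w, hw⟩ : ∃ w, w = v 3 / t := ⟨_, rfl⟩
    have hz2 : v 2 = t * z := by rw [hz]; field_simp
    have hw2 : v 3 = t * w := by rw [hw]; field_simp
    refine ⟨t, e, z, w, he7, ⟨?_, ?_, ?_⟩, by rw [← hu, hut], by rw [← hk, hkt], hz2, hw2⟩
    · rw [huk2, hz2, hw2] at k6
      refine (mul_eq_zero.1 (?_ : (t ^ 6 * e) * _ = 0)).resolve_left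
        (mul_ne_zero (pow_ne_zero 6 ht0) he0)
      have hk6' : k ^ 6 = t ^ 6 * e := by
        rw [hkt, mul_pow, inv_pow]
        congr 1
        field_simp
        linear_combination -he7
      rw [hk6', hut] at k6
      simp only [Gr, q] at k6 ⊢
      linear_combination k6
    · rw [huk2, hz2, hw2] at e2
      refine (mul_eq_zero.1 (?_ : t ^ 6 * _ = 0)).resolve_left (pow_ne_zero 6 ht0)
      simp only [Gz, q, qz] at e2 ⊢
      linear_combination e2
    · rw [huk2, hz2, hw2] at e3
      refine (mul_eq_zero.1 (?_ : t ^ 6 * _ = 0)).resolve_left (pow_ne_zero 6 ht0)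
      simp only [Gw, q, qw] at e3 ⊢
      linear_combination e3



/-- The primitive seventh root of unity. -/
noncomputable def zeta : ℂ := Complex.exp (2 * Real.pi * Complex.I / (7 : ℕ))

lemma zeta_prim : IsPrimitiveRoot zeta 7 := Complex.isPrimitiveRoot_exp 7 (by norm_num)

/-- Real representatives of the 99 singular points. -/
noncomputable def vec (pz pw : Fin 14 → ℝ) : Option (Fin 7 × Fin 14) → Fin 4 → ℝ
  | none => ![0, 0, 1, 0]
  | some (k, j) => ![(zeta ^ (k : ℕ)).re, (zeta ^ (k : ℕ)).im, pz j, pw j]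

/-- The same vectors over `ℂ`. -/
noncomputable def cvec (pz pw : Fin 14 → ℝ) (i : Option (Fin 7 × Fin 14)) : Fin 4 → ℂ :=
  fun l => (vec pz pw i l : ℂ)

lemma zeta_pow7 (k : ℕ) : (zeta ^ k) ^ 7 = 1 := by
  rw [← pow_mul, mul_comm, pow_mul, zeta_prim.pow_eq_one, one_pow]

lemma conj_of_pow7 (e : ℂ) (he : e ^ 7 = 1) : (e.re : ℂ) - e.im * Complex.I = e⁻¹ := by
  have h1 : ‖e‖ = 1 := Complex.norm_eq_one_of_pow_eq_one he (by norm_num)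
  rw [Complex.inv_eq_conj h1]
  apply Complex.ext <;> simp

lemma rsq_of_pow7 (e : ℂ) (he : e ^ 7 = 1) : (e.re : ℂ) ^ 2 + (e.im : ℂ) ^ 2 = 1 := by
  have h0 : e ≠ 0 := by
    rintro rfl
    norm_num at he
  have h1 := conj_of_pow7 e he
  have h2 := Complex.re_add_im e
  have h3 : ((e.re : ℂ) + e.im * Complex.I) * ((e.re : ℂ) - e.im * Complex.I) = 1 := by
    rw [h1, h2, mul_inv_cancel₀ h0]
  linear_combination h3 + (e.im : ℂ) ^ 2 * Complex.I_sq

lemma cvec_ne (pz pw : Fin 14 → ℝ) (i : Option (Fin 7 × Fin 14)) : cvec pz pw i ≠ 0 := by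
  intro h
  rcases i with _ | ⟨k, j⟩
  · have := congrFun h 2
    simp [cvec, vec] at this
  · have h0 := congrFun h 0
    have h1 := congrFun h 1
    have h2 := rsq_of_pow7 _ (zeta_pow7 k)
    simp only [cvec, vec, Matrix.cons_val_zero, Matrix.cons_val_one, Pi.zero_apply] at h0 h1
    rw [h0, h1] at h2
    norm_num at h2

lemma cvec_node (pz pw : Fin 14 → ℝ) (hs : ∀ j, PlaneSing (pz j) (pw j))
    (hD : ∀ j, dD (pz j) (pw j) ≠ 0) (i : Option (Fin 7 × Fin 14)) :
    VanishingJacobianAt (poly ℂ) (cvec pz pw i) ∧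
      (hessianAt (poly ℂ) (cvec pz pw i)).rank = 3 := by
  rcases i with _ | ⟨k, j⟩
  · have : cvec pz pw none = ![0, 0, 1, 0] := by
      ext l
      fin_cases l <;> simp [cvec, vec]
    rw [this]
    exact ⟨axis_sing, axis_node⟩
  · have he := zeta_pow7 k
    have hr := rsq_of_pow7 _ he
    have h7 : (((zeta ^ (k : ℕ)).re : ℂ) + (zeta ^ (k : ℕ)).im * Complex.I) ^ 7 = 1 := by
      rw [Complex.re_add_im, he]
    have h7' : (((zeta ^ (k : ℕ)).re : ℂ) - (zeta ^ (k : ℕ)).im * Complex.I) ^ 7 = 1 := by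
      rw [conj_of_pow7 _ he, inv_pow, he, inv_one]
    exact ⟨sing_of_plane (cvec pz pw (some (k, j))) hr h7 h7' (hs j),
      node_of_plane (cvec pz pw (some (k, j))) hr h7 h7' (hs j) (hD j)⟩

lemma cvec_inj (pz pw : Fin 14 → ℝ) (hinj : Function.Injective (fun j => (pz j, pw j)))
    (i i' : Option (Fin 7 × Fin 14)) (c : ℂ) (h : c • cvec pz pw i' = cvec pz pw i) : i = i' := by
  have g0 := congrFun h 0
  have g1 := congrFun h 1
  have g2 := congrFun h 2
  have g3 := congrFun h 3
  simp only [Pi.smul_apply, smul_eq_mul] at g0 g1 g2 g3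
  rcases i with _ | ⟨k, j⟩ <;> rcases i' with _ | ⟨k', j'⟩
  · rfl
  · exfalso
    have hr := rsq_of_pow7 _ (zeta_pow7 k')
    simp [cvec, vec] at g0 g1 g2
    rcases eq_or_ne c 0 with rfl | hc
    · simp at g2
    · rw [g0.resolve_left hc, g1.resolve_left hc] at hr
      norm_num at hr
  · exfalso
    have hr := rsq_of_pow7 _ (zeta_pow7 k)
    simp [cvec, vec] at g0 g1
    rw [← g0, ← g1] at hr
    norm_num at hr
  · have hr := rsq_of_pow7 _ (zeta_pow7 k)
    have hr' := rsq_of_pow7 _ (zeta_pow7 k')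
    have a0 : c * ((zeta ^ (k' : ℕ)).re : ℂ) = ((zeta ^ (k : ℕ)).re : ℂ) := g0
    have a1 : c * ((zeta ^ (k' : ℕ)).im : ℂ) = ((zeta ^ (k : ℕ)).im : ℂ) := g1
    have a2 : c * (pz j' : ℂ) = (pz j : ℂ) := g2
    have a3 : c * (pw j' : ℂ) = (pw j : ℂ) := g3
    have hz : c * zeta ^ (k' : ℕ) = zeta ^ (k : ℕ) := by
      rw [← Complex.re_add_im (zeta ^ (k' : ℕ)), ← Complex.re_add_im (zeta ^ (k : ℕ)), ← a0, ← a1]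
      ring
    have c2 : c ^ 2 = 1 := by
      rw [← a0, ← a1] at hr
      linear_combination hr - c ^ 2 * hr'
    have c7 : c ^ 7 = 1 := by
      have h7 := zeta_pow7 k
      rw [← hz, mul_pow, zeta_pow7, mul_one] at h7
      exact h7
    have c1 : c = 1 := by
      linear_combination c7 - (c ^ 5 + c ^ 3 + c) * c2
    rw [c1, one_mul] at hz a2 a3
    have hk : k' = k := Fin.ext (zeta_prim.pow_inj k'.2 k.2 hz)
    have hj : j' = j := hinj (Prod.ext (Complex.ofReal_injective a2) (Complex.ofReal_injective a3))
    rw [hk, hj]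

lemma cvec_complete (pz pw : Fin 14 → ℝ)
    (hc : ∀ z w : ℂ, PlaneSing z w → ∃ j, (pz j : ℂ) = z ∧ (pw j : ℂ) = w)
    (v : Fin 4 → ℂ) (h : VanishingJacobianAt (poly ℂ) v) :
    ∃ i, ∃ c : ℂ, c • cvec pz pw i = v := by
  rcases surface_complete v h with ⟨h0, h1, h3⟩ | ⟨t, e, z, w, he, hp, hu, hk, h2, h3⟩
  · refine ⟨none, v 2, ?_⟩
    ext l
    fin_cases l <;> simp [cvec, vec, h0, h1, h3]
  · obtain ⟨k, hk7, rfl⟩ := zeta_prim.eq_pow_of_pow_eq_one he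
    obtain ⟨j, rfl, rfl⟩ := hc z w hp
    have b1 := conj_of_pow7 _ he
    have b2 := Complex.re_add_im (zeta ^ k)
    rw [← b2] at hu
    rw [← b1] at hk
    refine ⟨some (⟨k, hk7⟩, j), t, ?_⟩
    ext l
    fin_cases l
    · change t * ((zeta ^ k).re : ℂ) = v 0
      linear_combination -(hu + hk) / 2
    · change t * ((zeta ^ k).im : ℂ) = v 1
      apply mul_left_cancel₀ Complex.I_ne_zero
      linear_combination -(hu - hk) / 2
    · exact h2.symm
    · exact h3.symm

end Septic


/-- There is a real homogeneous septic F ∈ ℝ[x,y,z,w] whose surface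
{F = 0} ⊂ ℙ³(ℂ) has exactly 99 singular points, all nodes, all real.
In particular μ^ℝ(7) ≥ 99. -/
theorem exists_real_septic_with_99_real_nodes :
    ∃ F : MvPolynomial (Fin 4) ℝ, F.IsHomogeneous 7 ∧
      {p : Projectivization ℂ (Fin 4 → ℂ) |
          IsSingularPoint (MvPolynomial.map (algebraMap ℝ ℂ) F) p}.ncard = 99 ∧
      (∀ p : Projectivization ℂ (Fin 4 → ℂ),
        IsSingularPoint (MvPolynomial.map (algebraMap ℝ ℂ) F) p →
          IsNode (MvPolynomial.map (algebraMap ℝ ℂ) F) p) ∧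
      (∀ p : Projectivization ℂ (Fin 4 → ℂ),
        IsSingularPoint (MvPolynomial.map (algebraMap ℝ ℂ) F) p →
          IsRealPoint p) := by
  obtain ⟨pz, pw, hinj, hs, hD, hc⟩ := Septic.exists_plane_points
  let Φ : Option (Fin 7 × Fin 14) → Projectivization ℂ (Fin 4 → ℂ) :=
    fun i => Projectivization.mk ℂ (Septic.cvec pz pw i) (Septic.cvec_ne pz pw i)
  have hΦ : Function.Injective Φ := by
    intro i i' h
    obtain ⟨c, hc'⟩ := (Projectivization.mk_eq_mk_iff' ℂ _ _ _ _).1 h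
    exact Septic.cvec_inj pz pw hinj i i' c hc'
  have hall : ∀ p, IsSingularPoint (Septic.poly ℂ) p → ∃ i, Φ i = p := by
    rintro p ⟨v, hv, rfl, hj⟩
    obtain ⟨i, c, h⟩ := Septic.cvec_complete pz pw hc v hj
    exact ⟨i, ((Projectivization.mk_eq_mk_iff' ℂ _ _ _ _).2 ⟨c, h⟩).symm⟩
  refine ⟨Septic.poly ℝ, Septic.poly_homogeneous, ?_, ?_, ?_⟩
  · rw [Septic.map_poly]
    have : {p | IsSingularPoint (Septic.poly ℂ) p} = Set.range Φ := by
      ext p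
      constructor
      · exact hall p
      · rintro ⟨i, rfl⟩
        exact ⟨_, Septic.cvec_ne pz pw i, rfl, (Septic.cvec_node pz pw hs hD i).1⟩
    rw [this, ← Set.image_univ, Set.ncard_image_of_injective _ hΦ, Set.ncard_univ]
    simp
  · rw [Septic.map_poly]
    intro p hp
    obtain ⟨i, rfl⟩ := hall p hp
    exact ⟨_, Septic.cvec_ne pz pw i, rfl, Septic.cvec_node pz pw hs hD i⟩
  · rw [Septic.map_poly]
    intro p hp
    obtain ⟨i, rfl⟩ := hall p hp
    exact ⟨_, Septic.cvec_ne pz pw i, rfl, fun l => ⟨Septic.vec pz pw i l, rfl⟩⟩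
end
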